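/- arXiv:math/0304051 — 6 statements merged into one kernel-verified Lean document; each statement's English description precedes it below -/
import Mathlib

section
/- Let (R, 𝔪) be a Noetherian local ring with residue field k = R/𝔪 and let S be an arbitrary (commutative) R-algebra. If Tor_1^R(S, k) = 0 and 𝔪S ≠ S, then the map R → S is cyclically pure; that is, IS ∩ R = I for every ideal I of R. -/
set_option synthInstance.maxHeartbeats 1000000
set_option maxHeartbeats 1000000
set_option linter.unusedVariables false

open CategoryTheory

/-- `Tor_n^R(M, N)`, the `n`-th Tor group of the `R`-modules `M` and `N`. -/
noncomputable abbrev TorGrp (R : Type) [CommRing R] (n : ℕ)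
    (M N : Type) [AddCommGroup M] [Module R M] [AddCommGroup N] [Module R N] : Type :=
  ((Tor (ModuleCat R) n).obj (ModuleCat.of R M)).obj (ModuleCat.of R N)

/-- The absolute integral closure `R⁺` of a domain `R`: the integral closure of `R`
in an algebraic closure of its fraction field. -/
noncomputable abbrev AbsIntClo (R : Type) [CommRing R] [IsDomain R] : Type :=
  integralClosure R (AlgebraicClosure (FractionRing R))

/-- A regular local ring: a Noetherian local ring whose maximal ideal can be generated
by Krull-dimension many elements. -/
def IsRegularLocalRingP (A : Type) [CommRing A] : Prop :=
  IsNoetherianRing A ∧ ∃ h : IsLocalRing A, ∃ s : Finset A,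
    Ideal.span (s : Set A) = @IsLocalRing.maximalIdeal A _ h ∧
      (s.card : WithBot ℕ∞) = ringKrullDim A

/-- A regular ring: a Noetherian ring all of whose localizations at primes are
regular local rings. -/
def IsRegularRingP (A : Type) [CommRing A] : Prop :=
  IsNoetherianRing A ∧
    ∀ (p : Ideal A) (hp : p.IsPrime),
      haveI := hp
      IsRegularLocalRingP (Localization.AtPrime p)

/-- A chain of primes is saturated if each step is a covering relation. -/
def IsSaturatedChain {α : Type} [Preorder α] (c : LTSeries α) : Prop :=
  ∀ i : Fin c.length, c.toFun i.castSucc ⋖ c.toFun i.succ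

/-- A ring is catenary if any two saturated chains of primes with the same endpoints
have the same length. -/
def IsCatenaryRing (A : Type) [CommRing A] : Prop :=
  ∀ c₁ c₂ : LTSeries (PrimeSpectrum A),
    c₁.head = c₂.head → c₁.last = c₂.last →
      IsSaturatedChain c₁ → IsSaturatedChain c₂ → c₁.length = c₂.length

/-- A ring is universally catenary if every finitely generated algebra over it
(i.e. every quotient of a polynomial ring over it) is catenary. -/
def IsUniversallyCatenary (A : Type) [CommRing A] : Prop :=
  ∀ (n : ℕ) (I : Ideal (MvPolynomial (Fin n) A)),
    IsCatenaryRing (MvPolynomial (Fin n) A ⧸ I)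

/-- A `κ`-algebra `B` is geometrically regular if `L ⊗_κ B` is a regular ring for
every finite field extension `L` of `κ`. -/
def IsGeometricallyRegularAlgebra (κ : Type) [Field κ] (B : Type) [CommRing B]
    [Algebra κ B] : Prop :=
  ∀ (L : Type) (_ : Field L) (_ : Algebra κ L) (_ : Module.Finite κ L),
    IsRegularRingP (TensorProduct κ L B)

/-- A ring `A` is a G-ring if for every prime `p` of `A`, all fibers of the completion
map `A_p → (A_p)^∧` are geometrically regular; the fiber at a prime `q` of `A_p` is
`κ(q) ⊗_{A_p} (A_p)^∧`. -/
def IsGRing (A : Type) [CommRing A] : Prop :=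
  ∀ (p : Ideal A) (hp : p.IsPrime),
    haveI := hp
    ∀ (q : Ideal (Localization.AtPrime p)) (hq : q.IsPrime),
      haveI := hq
      IsGeometricallyRegularAlgebra
        (IsLocalRing.ResidueField (Localization.AtPrime q))
        (TensorProduct (Localization.AtPrime p)
          (IsLocalRing.ResidueField (Localization.AtPrime q))
          (AdicCompletion (IsLocalRing.maximalIdeal (Localization.AtPrime p))
            (Localization.AtPrime p)))

/-- A ring `A` is J-2 if the regular locus of every finitely generated `A`-algebra
is open in its prime spectrum. -/
def IsJ2 (A : Type) [CommRing A] : Prop :=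
  ∀ (n : ℕ) (I : Ideal (MvPolynomial (Fin n) A)),
    IsOpen {p : PrimeSpectrum (MvPolynomial (Fin n) A ⧸ I) |
      IsRegularLocalRingP (Localization.AtPrime p.asIdeal)}

/-- A ring is excellent if it is Noetherian, universally catenary, a G-ring, and J-2. -/
def IsExcellentRing (A : Type) [CommRing A] : Prop :=
  IsNoetherianRing A ∧ IsUniversallyCatenary A ∧ IsGRing A ∧ IsJ2 A

/-- A list of elements of a local ring is a system of parameters if its elements lie in
the maximal ideal, its length is the Krull dimension, and the ideal it generates has
radical the maximal ideal (i.e. is primary to the maximal ideal). -/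
def IsSystemOfParameters (R : Type) [CommRing R] [IsLocalRing R] (rs : List R) : Prop :=
  (∀ x ∈ rs, x ∈ IsLocalRing.maximalIdeal R) ∧
    (rs.length : WithBot ℕ∞) = ringKrullDim R ∧
    (Ideal.ofList rs).radical = IsLocalRing.maximalIdeal R

/-- A local ring is Cohen-Macaulay if it is Noetherian and admits a regular sequence of
length equal to its Krull dimension consisting of elements of the maximal ideal. -/
def IsCohenMacaulayLocalRing (R : Type) [CommRing R] : Prop :=
  IsNoetherianRing R ∧ ∃ h : IsLocalRing R,
    ∃ rs : List R, (∀ x ∈ rs, x ∈ @IsLocalRing.maximalIdeal R _ h) ∧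
      RingTheory.Sequence.IsRegular R rs ∧ (rs.length : WithBot ℕ∞) = ringKrullDim R

/-- An `R`-algebra `S` is a big Cohen-Macaulay `R`-algebra if some system of parameters
of `R` is an `S`-regular sequence. -/
def IsBigCohenMacaulayAlgebra (R : Type) [CommRing R] [IsLocalRing R]
    (S : Type) [CommRing S] [Algebra R S] : Prop :=
  ∃ rs : List R, IsSystemOfParameters R rs ∧ RingTheory.Sequence.IsRegular S rs
/-- `S ⊗ -` preserves injectivity of every injection with cokernel `N`. For `R`-modules `S`, `N`
this is equivalent to the vanishing of `Tor₁(S, N)`. -/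
def PreservesInjectionsWithCokernel (R : Type) [CommRing R] (S : Type) [AddCommGroup S]
    [Module R S] (N : Type) [AddCommGroup N] [Module R N] : Prop :=
  ∀ (A B : Type) [AddCommGroup A] [Module R A] [AddCommGroup B] [Module R B]
    (f : A →ₗ[R] B) (g : B →ₗ[R] N), Function.Injective f → Function.Exact f g →
    Function.Surjective g → Function.Injective (f.lTensor S)

namespace PreservesInjectionsWithCokernel

variable {R : Type} [CommRing R] {S : Type} [AddCommGroup S] [Module R S]
  {N N' : Type} [AddCommGroup N] [Module R N] [AddCommGroup N'] [Module R N']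

theorem congr (e : N ≃ₗ[R] N') (h : PreservesInjectionsWithCokernel R S N) :
    PreservesInjectionsWithCokernel R S N' := by
  intro A B _ _ _ _ f g hf hfg hg
  refine h A B f (e.symm.toLinearMap ∘ₗ g) hf (fun b => ?_) (e.symm.surjective.comp hg)
  simpa using hfg b

theorem of_subsingleton [Subsingleton N] : PreservesInjectionsWithCokernel R S N := by
  intro A B _ _ _ _ f g hf hfg hg
  have hs : Function.Surjective f := fun b => (hfg b).1 (Subsingleton.elim _ _)
  exact ((LinearEquiv.ofBijective f ⟨hf, hs⟩).lTensor S).injective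

theorem of_submodule_of_quotient {P : Submodule R N} (hP : PreservesInjectionsWithCokernel R S P)
    (hQ : PreservesInjectionsWithCokernel R S (N ⧸ P)) :
    PreservesInjectionsWithCokernel R S N := by
  intro A B _ _ _ _ f g hf hfg hg
  let C : Submodule R B := P.comap g
  have hfC : ∀ a, f a ∈ C := fun a => by simp [C, hfg.apply_apply_eq_zero]
  let f' : A →ₗ[R] C := f.codRestrict C hfC
  let g' : C →ₗ[R] P := g.restrict fun _ h => h
  have h₁ : Function.Injective (f'.lTensor S) := by
    refine hP A C f' g' (fun a b hab => hf (congrArg Subtype.val hab)) (fun c => ?_) fun p => ?_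
    · rw [Subtype.ext_iff]
      refine (hfg c).trans ⟨?_, ?_⟩
      · rintro ⟨a, ha⟩
        exact ⟨a, Subtype.ext ha⟩
      · rintro ⟨a, ha⟩
        exact ⟨a, congrArg Subtype.val ha⟩
    · obtain ⟨b, hb⟩ := hg p
      exact ⟨⟨b, by simp [C, hb]⟩, Subtype.ext hb⟩
  have h₂ : Function.Injective (C.subtype.lTensor S) := by
    refine hQ C B C.subtype (P.mkQ ∘ₗ g) C.injective_subtype (fun b => ?_)
      (P.mkQ_surjective.comp hg)
    simp [C]
  have hcomp : f = C.subtype ∘ₗ f' := rfl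
  rw [hcomp, LinearMap.lTensor_comp]
  exact h₂.comp h₁

/-- If `A → B → N` and `K → P → N` are short exact with `P` projective, and `S ⊗ K → S ⊗ P` is
injective, then so is `S ⊗ A → S ⊗ B`. -/
theorem of_projective_presentation {K P : Type} [AddCommGroup K] [Module R K] [AddCommGroup P]
    [Module R P] [Module.Projective R P] (i : K →ₗ[R] P) (p : P →ₗ[R] N)
    (hip : Function.Exact i p) (hp : Function.Surjective p)
    (hi : Function.Injective (i.lTensor S)) : PreservesInjectionsWithCokernel R S N := by
  intro A B _ _ _ _ f g hf hfg hg
  obtain ⟨l, hl⟩ := Module.projective_lifting_property g p hg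
  have hl' : ∀ x, g (l x) = p x := fun x => LinearMap.congr_fun hl x
  have hK : ∀ k, l (i k) ∈ LinearMap.range f := fun k =>
    (hfg _).1 (by rw [hl', hip.apply_apply_eq_zero])
  let u : K →ₗ[R] A :=
    (LinearEquiv.ofInjective f hf).symm.toLinearMap ∘ₗ (l ∘ₗ i).codRestrict _ hK
  have hu : ∀ k, f (u k) = l (i k) := fun k => by
    have := (LinearEquiv.ofInjective f hf).apply_symm_apply ⟨l (i k), hK k⟩
    exact congrArg Subtype.val this
  let α : K →ₗ[R] A × P := u.prod (-i)
  let β : A × P →ₗ[R] B := f.coprod l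
  have hαβ : Function.Exact α β := by
    rintro ⟨a, x⟩
    constructor
    · intro h
      have h' : f a + l x = 0 := h
      have hx : p x = 0 := by
        simpa [hl', hfg.apply_apply_eq_zero] using congrArg g h'
      obtain ⟨k, rfl⟩ := (hip x).1 hx
      refine ⟨-k, Prod.ext (hf ?_) ?_⟩
      · simp [α, hu, eq_neg_of_add_eq_zero_left h']
      · simp [α]
    · rintro ⟨k, hk⟩
      rw [← hk]
      simp [α, β, hu]
  have hβ : Function.Surjective β := by
    intro b
    obtain ⟨x, hx⟩ := hp (g b)
    obtain ⟨a, ha⟩ := (hfg (b - l x)).1 (by rw [map_sub, hl', hx, sub_self])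
    exact ⟨(a, x), by simp [β, ha]⟩
  rw [injective_iff_map_eq_zero]
  intro z hz
  have hz' : β.lTensor S ((LinearMap.inl R A P).lTensor S z) = 0 := by
    rw [← LinearMap.comp_apply, ← LinearMap.lTensor_comp, LinearMap.coprod_inl, hz]
  obtain ⟨w, hw⟩ := (lTensor_exact S hαβ hβ _).1 hz'
  have hw₀ : i.lTensor S w = 0 := by
    have := congrArg ((LinearMap.snd R A P).lTensor S) hw
    rw [← LinearMap.comp_apply, ← LinearMap.comp_apply, ← LinearMap.lTensor_comp,
      ← LinearMap.lTensor_comp, LinearMap.snd_comp_inl, LinearMap.snd_prod] at this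
    simpa using this
  rw [hi (hw₀.trans (map_zero _).symm), map_zero] at hw
  have := congrArg ((LinearMap.fst R A P).lTensor S) hw
  rw [← LinearMap.comp_apply, ← LinearMap.lTensor_comp, LinearMap.fst_comp_inl] at this
  simpa using this.symm

theorem of_projective_resolution {P₂ P₁ P₀ : Type} [AddCommGroup P₂] [Module R P₂]
    [AddCommGroup P₁] [Module R P₁] [AddCommGroup P₀] [Module R P₀] [Module.Projective R P₀]
    (d₂ : P₂ →ₗ[R] P₁) (d₁ : P₁ →ₗ[R] P₀) (p : P₀ →ₗ[R] N) (h₂₁ : d₁ ∘ₗ d₂ = 0)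
    (h₁ : Function.Exact d₁ p) (hp : Function.Surjective p)
    (hS : Function.Exact (d₂.lTensor S) (d₁.lTensor S)) :
    PreservesInjectionsWithCokernel R S N := by
  refine of_projective_presentation (LinearMap.range d₁).subtype p (fun x => ?_) hp ?_
  · simpa using h₁ x
  rw [injective_iff_map_eq_zero]
  intro z hz
  obtain ⟨y, rfl⟩ := LinearMap.lTensor_surjective S d₁.surjective_rangeRestrict z
  rw [← LinearMap.comp_apply, ← LinearMap.lTensor_comp] at hz
  obtain ⟨w, rfl⟩ := (hS y).1 hz
  have h0 : d₁.rangeRestrict ∘ₗ d₂ = 0 :=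
    LinearMap.ext fun x => Subtype.ext (LinearMap.congr_fun h₂₁ x)
  rw [← LinearMap.comp_apply, ← LinearMap.lTensor_comp, h0, LinearMap.lTensor_zero,
    LinearMap.zero_apply]

theorem of_subsingleton_tor (h : Subsingleton (TorGrp R 1 S N)) :
    PreservesInjectionsWithCokernel R S N := by
  let Q := ProjectiveResolution.of (ModuleCat.of R N)
  let F := (MonoidalCategory.tensoringLeft (ModuleCat.{0} R)).obj (ModuleCat.of R S)
  have hZ : Limits.IsZero ((F.leftDerived 1).obj (ModuleCat.of R N)) :=
    @ModuleCat.isZero_of_subsingleton R _ _ h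
  have hE : ((F.mapHomologicalComplex _).obj Q.complex).ExactAt 1 :=
    (HomologicalComplex.exactAt_iff_isZero_homology _ _).2
      (hZ.of_iso (Q.isoLeftDerivedObj F 1).symm)
  rw [HomologicalComplex.exactAt_iff' _ 2 1 0 (by simp) (by simp)] at hE
  have hS := (ShortComplex.ShortExact.moduleCat_exact_iff_function_exact _).1 hE
  have h₁ := (ShortComplex.ShortExact.moduleCat_exact_iff_function_exact _).1 Q.exact₀
  have : Module.Projective R (Q.complex.X 0) :=
    (IsProjective.iff_projective _).2 (Q.projective 0)
  refine of_projective_resolution (Q.complex.d 2 1).hom (Q.complex.d 1 0).hom (Q.π.f 0).hom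
    ?_ h₁ ((ModuleCat.epi_iff_surjective _).1 inferInstance) hS
  rw [← ModuleCat.hom_comp, Q.complex.d_comp_d, ModuleCat.hom_zero]

theorem of_isFiniteLength [IsLocalRing R]
    (hk : PreservesInjectionsWithCokernel R S (IsLocalRing.ResidueField R))
    (hN : IsFiniteLength R N) : PreservesInjectionsWithCokernel R S N := by
  induction hN with
  | of_subsingleton => exact of_subsingleton
  | @of_simple_quotient M _ _ P hs _ ih =>
    obtain ⟨I, hI, ⟨e⟩⟩ := isSimpleModule_iff_quot_maximal.1 hs
    obtain rfl := IsLocalRing.eq_maximalIdeal hI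
    exact of_submodule_of_quotient ih (hk.congr e.symm)

end PreservesInjectionsWithCokernel

open TensorProduct in
theorem one_tmul_eq_zero_iff {R S : Type} [CommRing R] [CommRing S] [Algebra R S] (J : Ideal R)
    (x : R) : (1 : S) ⊗ₜ[R] (Ideal.Quotient.mk J x) = 0 ↔
      algebraMap R S x ∈ J.map (algebraMap R S) := by
  rw [← (TensorProduct.tensorQuotEquivQuotSMul S J).map_eq_zero_iff,
    TensorProduct.tensorQuotEquivQuotSMul_tmul_mk, Submodule.Quotient.mk_eq_zero,
    Ideal.smul_top_eq_map, Submodule.restrictScalars_mem, Algebra.algebraMap_eq_smul_one]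

/-- If `Tor₁(S, k) = 0` and `𝔪S ≠ S`, then `M → S ⊗ M` is injective for `M` of finite length. -/
theorem tensorProduct_mk_one_injective_of_isFiniteLength {R S : Type} [CommRing R] [IsLocalRing R]
    [CommRing S] [Algebra R S]
    (hk : PreservesInjectionsWithCokernel R S (IsLocalRing.ResidueField R))
    (hmS : Ideal.map (algebraMap R S) (IsLocalRing.maximalIdeal R) ≠ ⊤)
    {M : Type} [AddCommGroup M] [Module R M] (hM : IsFiniteLength R M) :
    Function.Injective (TensorProduct.mk R S M 1) := by
  have := (isFiniteLength_iff_isNoetherian_isArtinian.1 hM).2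
  rw [← LinearMap.ker_eq_bot]
  by_contra hne
  obtain ⟨W, hW, hle⟩ := (eq_bot_or_exists_atom_le _).resolve_left hne
  have hs : IsSimpleModule R W := isSimpleModule_iff_isAtom.2 hW
  obtain ⟨I, hI, ⟨e⟩⟩ := isSimpleModule_iff_quot_maximal.1 hs
  obtain rfl := IsLocalRing.eq_maximalIdeal hI
  have hinj : Function.Injective (W.subtype.lTensor S) :=
    hk.of_isFiniteLength (hM.of_surjective W.mkQ_surjective) W M W.subtype W.mkQ
      W.injective_subtype (LinearMap.exact_subtype_mkQ W) W.mkQ_surjective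
  have hzero : ∀ w : W, TensorProduct.tmul R (1 : S) w = 0 := fun w =>
    hinj ((LinearMap.lTensor_tmul _ _ _ _).trans ((hle w.2).trans (map_zero _).symm))
  have h1 := congrArg (e.toLinearMap.lTensor S) (hzero (e.symm (Ideal.Quotient.mk _ 1)))
  rw [LinearMap.lTensor_tmul, LinearEquiv.coe_coe, e.apply_symm_apply, map_zero,
    one_tmul_eq_zero_iff, map_one] at h1
  exact hmS ((Ideal.eq_top_iff_one _).2 h1)

theorem isFiniteLength_quotient_of_pow_maximalIdeal_le {R : Type} [CommRing R] [IsNoetherianRing R]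
    [IsLocalRing R] {J : Ideal R} {n : ℕ} (hJ : IsLocalRing.maximalIdeal R ^ n ≤ J) :
    IsFiniteLength R (R ⧸ J) := by
  rcases subsingleton_or_nontrivial (R ⧸ J) with _ | _
  · exact .of_subsingleton
  have : IsLocalRing (R ⧸ J) := .of_surjective' _ Ideal.Quotient.mk_surjective
  have hmap : (IsLocalRing.maximalIdeal R).map (Ideal.Quotient.mk J) =
      IsLocalRing.maximalIdeal (R ⧸ J) :=
    IsLocalRing.map_maximalIdeal_of_surjective _ Ideal.Quotient.mk_surjective
  have : IsArtinianRing (R ⧸ J) := by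
    refine (isArtinianRing_iff_isNilpotent_maximalIdeal _).2 ⟨n, ?_⟩
    rw [← hmap, ← Ideal.map_pow, Ideal.zero_eq_bot, Ideal.map_eq_bot_iff_le_ker, Ideal.mk_ker]
    exact hJ
  exact isFiniteLength_iff_isNoetherian_isArtinian.2 ⟨inferInstance,
    isArtinian_of_surjective_algebraMap (R := R ⧸ J) Ideal.Quotient.mk_surjective⟩

/-- **Krull's intersection theorem**: every ideal of a Noetherian local ring is closed. -/
theorem Ideal.mem_of_forall_mem_sup_pow_maximalIdeal {R : Type} [CommRing R] [IsNoetherianRing R]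
    [IsLocalRing R] {I : Ideal R} {x : R} (h : ∀ n, x ∈ I ⊔ IsLocalRing.maximalIdeal R ^ n) :
    x ∈ I := by
  have hbot := Ideal.iInf_pow_smul_eq_bot_of_isLocalRing (M := R ⧸ I) (IsLocalRing.maximalIdeal R)
    Ideal.IsPrime.ne_top'
  rw [← Ideal.Quotient.eq_zero_iff_mem, ← Submodule.mem_bot R, ← hbot, Submodule.mem_iInf]
  intro n
  obtain ⟨a, ha, b, hb, rfl⟩ := Submodule.mem_sup.1 (h n)
  rw [map_add, Ideal.Quotient.eq_zero_iff_mem.2 ha, zero_add, ← mul_one b, map_mul]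
  exact Submodule.smul_mem_smul hb (Submodule.mem_top (x := (1 : R ⧸ I)))

/-- If `(R, 𝔪)` is a Noetherian local ring with residue field `k`, `S` is an `R`-algebra
with `Tor_1^R(S, k) = 0` and `𝔪S ≠ S`, then `R → S` is cyclically pure:
`IS ∩ R = I` for every ideal `I` of `R`. -/
theorem tor_one_vanishing_cyclically_pure
    (R : Type) [CommRing R] [IsNoetherianRing R] [IsLocalRing R]
    (S : Type) [CommRing S] [Algebra R S]
    (htor : Subsingleton (TorGrp R 1 S (IsLocalRing.ResidueField R)))
    (hmS : Ideal.map (algebraMap R S) (IsLocalRing.maximalIdeal R) ≠ ⊤) :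
    ∀ I : Ideal R, Ideal.comap (algebraMap R S) (Ideal.map (algebraMap R S) I) = I := by
  intro I
  refine le_antisymm (fun x hx => ?_) Ideal.le_comap_map
  refine Ideal.mem_of_forall_mem_sup_pow_maximalIdeal fun n => ?_
  have hinj := tensorProduct_mk_one_injective_of_isFiniteLength
    (PreservesInjectionsWithCokernel.of_subsingleton_tor htor) hmS
    (isFiniteLength_quotient_of_pow_maximalIdeal_le
      (le_sup_right : IsLocalRing.maximalIdeal R ^ n ≤ I ⊔ IsLocalRing.maximalIdeal R ^ n))
  rw [← Ideal.Quotient.eq_zero_iff_mem]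
  refine hinj (((one_tmul_eq_zero_iff _ x).2 ?_).trans (map_zero _).symm)
  exact Ideal.map_mono le_sup_left hx
end

section
/- Let (R, 𝔪) be a Noetherian local ring with residue field k = R/𝔪 and let S be an R-algebra with Tor_1^R(S, k) = 0 and 𝔪S ≠ S. Then the induced map Spec S → Spec R is surjective; that is, every prime ideal 𝔭 of R is the contraction of some prime ideal of S (equivalently, every fiber ring S_𝔭/𝔭S_𝔭 is nonzero). -/
set_option synthInstance.maxHeartbeats 1000000
set_option maxHeartbeats 1000000
set_option linter.unusedVariables false

open CategoryTheory

open TensorProduct in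
/-- Elementary form of `Tor₁(S, N) = 0`: tensoring with `S` preserves the injectivity of the
kernel of every surjection onto `N`. -/
def LTensorKernelsInjective (R S : Type) [CommRing R] [AddCommGroup S] [Module R S]
    (N : Type) [AddCommGroup N] [Module R N] : Prop :=
  ∀ (A B : Type) [AddCommGroup A] [Module R A] [AddCommGroup B] [Module R B]
    (f : A →ₗ[R] B) (g : B →ₗ[R] N),
    Function.Injective f → Function.Exact f g → Function.Surjective g →
      Function.Injective (f.lTensor S)

namespace LTensorKernelsInjective

variable {R S : Type} [CommRing R] [AddCommGroup S] [Module R S]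
variable {N N' : Type} [AddCommGroup N] [Module R N] [AddCommGroup N'] [Module R N']

theorem congr (e : N ≃ₗ[R] N') (h : LTensorKernelsInjective R S N) :
    LTensorKernelsInjective R S N' := by
  intro A B _ _ _ _ f g hf hfg hg
  refine h A B f (e.symm.toLinearMap ∘ₗ g) hf (fun x ↦ ?_) (e.symm.surjective.comp hg)
  simpa using hfg x

theorem of_subsingleton [Subsingleton N] : LTensorKernelsInjective R S N := by
  intro A B _ _ _ _ f g hf hfg _
  have hs : Function.Surjective f := fun x ↦ (hfg x).1 (Subsingleton.elim _ _)
  exact (LinearEquiv.lTensor S (LinearEquiv.ofBijective f ⟨hf, hs⟩)).injective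

theorem of_submodule_quotient (L : Submodule R N) (hL : LTensorKernelsInjective R S L)
    (hQ : LTensorKernelsInjective R S (N ⧸ L)) : LTensorKernelsInjective R S N := by
  intro A B _ _ _ _ f g hf hfg hg
  let B' : Submodule R B := L.comap g
  have hA (a : A) : f a ∈ B' := by
    simp [B', hfg.apply_apply_eq_zero]
  let f' : A →ₗ[R] B' := f.codRestrict B' hA
  let g' : B' →ₗ[R] L := g.restrict fun x hx ↦ hx
  have h₁ : Function.Injective (f'.lTensor S) := by
    refine hL A B' f' g' (fun x y hxy ↦ hf (congrArg Subtype.val hxy)) (fun x ↦ ?_) ?_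
    · refine ⟨fun hx ↦ ?_, ?_⟩
      · obtain ⟨a, ha⟩ := (hfg x.1).1 (congrArg Subtype.val hx)
        exact ⟨a, Subtype.ext ha⟩
      · rintro ⟨a, rfl⟩
        exact Subtype.ext (hfg.apply_apply_eq_zero a)
    · rintro ⟨y, hy⟩
      obtain ⟨b, rfl⟩ := hg y
      exact ⟨⟨b, hy⟩, rfl⟩
  have h₂ : Function.Injective (B'.subtype.lTensor S) := by
    refine hQ B' B B'.subtype (L.mkQ ∘ₗ g) B'.injective_subtype (fun x ↦ ?_)
      (L.mkQ_surjective.comp hg)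
    simp [B']
  have h : f = B'.subtype ∘ₗ f' := rfl
  rw [h, LinearMap.lTensor_comp]
  exact h₂.comp h₁

theorem of_resolution {F₀ F₁ F₂ : Type} [AddCommGroup F₀] [Module R F₀] [AddCommGroup F₁]
    [Module R F₁] [AddCommGroup F₂] [Module R F₂] [Module.Projective R F₀]
    [Module.Projective R F₁] (d₂ : F₂ →ₗ[R] F₁) (d₁ : F₁ →ₗ[R] F₀) (ε : F₀ →ₗ[R] N)
    (hε : Function.Surjective ε) (h₁ : Function.Exact d₁ ε) (h₂ : d₁ ∘ₗ d₂ = 0)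
    (hS : Function.Exact (d₂.lTensor S) (d₁.lTensor S)) :
    LTensorKernelsInjective R S N := by
  intro A B _ _ _ _ f g hf hfg hg
  obtain ⟨φ₀, hφ₀⟩ := Module.projective_lifting_property g ε hg
  have hφ₀' (x : F₀) : g (φ₀ x) = ε x := LinearMap.congr_fun hφ₀ x
  obtain ⟨φ₁, hφ₁⟩ : ∃ φ₁ : F₁ →ₗ[R] A, f ∘ₗ φ₁ = φ₀ ∘ₗ d₁ := by
    have hmem (x : F₁) : φ₀ (d₁ x) ∈ LinearMap.range f :=
      (hfg _).1 (by rw [hφ₀', h₁.apply_apply_eq_zero])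
    refine ⟨(LinearEquiv.ofInjective f hf).symm.toLinearMap ∘ₗ
      (φ₀ ∘ₗ d₁).codRestrict (LinearMap.range f) hmem, LinearMap.ext fun x ↦ ?_⟩
    exact congrArg Subtype.val ((LinearEquiv.ofInjective f hf).apply_symm_apply ⟨_, hmem x⟩)
  have hφ₁' (x : F₁) : f (φ₁ x) = φ₀ (d₁ x) := LinearMap.congr_fun hφ₁ x
  have hφ₁d : φ₁ ∘ₗ d₂ = 0 := by
    ext x
    apply hf
    have : d₁ (d₂ x) = 0 := LinearMap.congr_fun h₂ x
    simp [hφ₁', this]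
  let i : F₁ →ₗ[R] F₀ × A := d₁.prod (-φ₁)
  let q : F₀ × A →ₗ[R] B := φ₀.coprod f
  have hiq : Function.Exact i q := by
    rintro ⟨x, a⟩
    refine ⟨fun h ↦ ?_, ?_⟩
    · have h' : φ₀ x + f a = 0 := h
      have hx : ε x = 0 := by
        simpa [hφ₀', hfg.apply_apply_eq_zero] using congrArg g h'
      obtain ⟨y, rfl⟩ := (h₁ x).1 hx
      refine ⟨y, Prod.ext rfl (hf ?_)⟩
      change f (-φ₁ y) = f a
      rw [map_neg, hφ₁']
      exact (eq_neg_of_add_eq_zero_right h').symm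
    · rintro ⟨y, hy⟩
      rw [← hy]
      simp [i, q, hφ₁']
  have hq : Function.Surjective q := by
    intro b
    obtain ⟨x, hx⟩ := hε (g b)
    obtain ⟨a, ha⟩ := (hfg (b - φ₀ x)).1 (by rw [map_sub, hφ₀', hx, sub_self])
    exact ⟨(x, a), by simp [q, ha]⟩
  rw [injective_iff_map_eq_zero]
  intro x hx
  obtain ⟨z, hz⟩ := (lTensor_exact S hiq hq ((LinearMap.inr R F₀ A).lTensor S x)).1 (by
    rw [← LinearMap.lTensor_comp_apply, LinearMap.coprod_inr, hx])
  have hz₁ : d₁.lTensor S z = 0 := by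
    have := congrArg ((LinearMap.fst R F₀ A).lTensor S) hz
    rwa [← LinearMap.lTensor_comp_apply, ← LinearMap.lTensor_comp_apply, LinearMap.fst_comp_inr,
      LinearMap.fst_prod, LinearMap.lTensor_zero, LinearMap.zero_apply] at this
  have hz₂ : (-φ₁).lTensor S z = x := by
    have := congrArg ((LinearMap.snd R F₀ A).lTensor S) hz
    rwa [← LinearMap.lTensor_comp_apply, ← LinearMap.lTensor_comp_apply, LinearMap.snd_comp_inr,
      LinearMap.snd_prod, LinearMap.lTensor_id, LinearMap.id_apply] at this
  obtain ⟨w, rfl⟩ := (hS z).1 hz₁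
  rw [← hz₂, ← LinearMap.lTensor_comp_apply, LinearMap.neg_comp, hφ₁d, neg_zero,
    LinearMap.lTensor_zero, LinearMap.zero_apply]

theorem of_subsingleton_torGrp (h : Subsingleton (TorGrp R 1 S N)) :
    LTensorKernelsInjective R S N := by
  let P := projectiveResolution (ModuleCat.of R N)
  let F := (MonoidalCategory.tensoringLeft (ModuleCat R)).obj (ModuleCat.of R S)
  have hzero : Limits.IsZero ((F.leftDerived 1).obj (ModuleCat.of R N)) :=
    @ModuleCat.isZero_of_subsingleton _ _ _ h
  have hhom := hzero.of_iso (P.isoLeftDerivedObj F 1).symm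
  have hex : ((F.mapHomologicalComplex _).obj P.complex).ExactAt 1 := by
    rwa [HomologicalComplex.exactAt_iff_isZero_homology]
  rw [HomologicalComplex.exactAt_iff' _ 2 1 0 (by simp) (by simp),
    ShortComplex.ShortExact.moduleCat_exact_iff_function_exact] at hex
  have hP₀ : Module.Projective R (P.complex.X 0) :=
    (IsProjective.iff_projective _).2 (P.projective 0)
  have hP₁ : Module.Projective R (P.complex.X 1) :=
    (IsProjective.iff_projective _).2 (P.projective 1)
  have h₁ := (ShortComplex.ShortExact.moduleCat_exact_iff_function_exact _).1 P.exact₀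
  have h₂ : (P.complex.d 1 0).hom ∘ₗ (P.complex.d 2 1).hom = 0 :=
    congrArg ModuleCat.Hom.hom (P.complex.d_comp_d 2 1 0)
  have hε : Function.Surjective (P.π.f 0).hom :=
    (ModuleCat.epi_iff_surjective _).1 inferInstance
  exact of_resolution (P.complex.d 2 1).hom (P.complex.d 1 0).hom (P.π.f 0).hom hε h₁ h₂ hex

theorem of_isFiniteLength [IsLocalRing R]
    (hk : LTensorKernelsInjective R S (IsLocalRing.ResidueField R))
    (hN : IsFiniteLength R N) : LTensorKernelsInjective R S N := by
  induction hN with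
  | of_subsingleton => exact of_subsingleton
  | @of_simple_quotient M _ _ L hL _ ih =>
    refine of_submodule_quotient L ih ?_
    obtain ⟨I, hI, ⟨e⟩⟩ := isSimpleModule_iff_quot_maximal.1 hL
    obtain rfl := IsLocalRing.eq_maximalIdeal hI
    exact hk.congr e.symm

end LTensorKernelsInjective

theorem IsLocalRing.isFiniteLength_quotient_of_maximalIdeal_pow_le {R : Type*} [CommRing R]
    [IsNoetherianRing R] [IsLocalRing R] {I : Ideal R} {n : ℕ}
    (h : IsLocalRing.maximalIdeal R ^ n ≤ I) : IsFiniteLength R (R ⧸ I) := by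
  by_cases hI : I = ⊤
  · subst hI
    exact .of_subsingleton
  have : IsArtinianRing (R ⧸ I) :=
    IsLocalRing.quotient_artinian_of_mem_minimalPrimes_of_isLocalRing I
      ⟨⟨inferInstance, IsLocalRing.le_maximalIdeal hI⟩,
        fun q hq _ ↦ hq.1.le_of_pow_le (h.trans hq.2)⟩
  rw [isFiniteLength_iff_isNoetherian_isArtinian]
  exact ⟨inferInstance,
    isArtinian_of_surjective_algebraMap (Ideal.Quotient.mk_surjective (I := I))⟩

open TensorProduct in
theorem Ideal.one_tmul_mk_eq_zero_iff {R S : Type*} [CommRing R] [CommRing S] [Algebra R S]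
    (I : Ideal R) (r : R) :
    (1 : S) ⊗ₜ[R] Ideal.Quotient.mk I r = 0 ↔ algebraMap R S r ∈ I.map (algebraMap R S) := by
  rw [← (tensorQuotEquivQuotSMul S I).map_eq_zero_iff, tensorQuotEquivQuotSMul_tmul_mk,
    Submodule.Quotient.mk_eq_zero, Ideal.smul_top_eq_map, Submodule.restrictScalars_mem,
    Algebra.smul_def, mul_one]

open TensorProduct in
/-- Ideals containing a power of the maximal ideal are contracted from `S`. -/
theorem LTensorKernelsInjective.comap_map_le {R S : Type} [CommRing R] [IsNoetherianRing R]
    [IsLocalRing R] [CommRing S] [Algebra R S]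
    (hk : LTensorKernelsInjective R S (IsLocalRing.ResidueField R))
    (hmS : Ideal.map (algebraMap R S) (IsLocalRing.maximalIdeal R) ≠ ⊤)
    {I : Ideal R} {n : ℕ} (hI : IsLocalRing.maximalIdeal R ^ n ≤ I) :
    (I.map (algebraMap R S)).comap (algebraMap R S) ≤ I := by
  intro s hs
  by_contra hsI
  let t : R →ₗ[R] R ⧸ I := LinearMap.toSpanSingleton R (R ⧸ I) (Ideal.Quotient.mk I s)
  let J : Ideal R := LinearMap.ker t
  have hJ : J ≤ IsLocalRing.maximalIdeal R := by
    refine IsLocalRing.le_maximalIdeal fun h ↦ hsI ?_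
    have h1 : (1 : R) ∈ J := h ▸ Submodule.mem_top
    simpa [J, t, Ideal.Quotient.eq_zero_iff_mem] using h1
  let f : (R ⧸ J) →ₗ[R] R ⧸ I := J.liftQ t le_rfl
  have hf : Function.Injective f := LinearMap.ker_eq_bot.1 (Submodule.ker_liftQ_eq_bot' _ _ rfl)
  have hQ : IsFiniteLength R ((R ⧸ I) ⧸ LinearMap.range f) :=
    (IsLocalRing.isFiniteLength_quotient_of_maximalIdeal_pow_le hI).of_surjective
      (LinearMap.range f).mkQ_surjective
  have hinj := hk.of_isFiniteLength hQ _ _ f (LinearMap.range f).mkQ hf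
    (LinearMap.exact_map_mkQ_range f) (LinearMap.range f).mkQ_surjective
  have h1 : (1 : S) ⊗ₜ[R] Ideal.Quotient.mk J 1 = 0 := by
    apply hinj
    have hf1 : f (Ideal.Quotient.mk J 1) = Ideal.Quotient.mk I s :=
      one_smul R (Ideal.Quotient.mk I s)
    rw [LinearMap.lTensor_tmul, hf1, map_zero]
    exact (Ideal.one_tmul_mk_eq_zero_iff I s).2 hs
  rw [Ideal.one_tmul_mk_eq_zero_iff, map_one] at h1
  exact hmS ((Ideal.eq_top_iff_one _).2 (Ideal.map_mono hJ h1))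

theorem IsLocalRing.mem_of_forall_mem_sup_maximalIdeal_pow {R : Type*} [CommRing R]
    [IsNoetherianRing R] [IsLocalRing R] {I : Ideal R} {x : R}
    (h : ∀ n : ℕ, x ∈ I ⊔ IsLocalRing.maximalIdeal R ^ n) : x ∈ I := by
  rw [← Ideal.Quotient.eq_zero_iff_mem]
  have hH : IsHausdorff (IsLocalRing.maximalIdeal R) (R ⧸ I) := inferInstance
  refine hH.haus _ fun n ↦ ?_
  rw [SModEq.zero, Ideal.smul_top_eq_map, Submodule.restrictScalars_mem,
    Ideal.Quotient.algebraMap_eq, Ideal.mem_quotient_iff_mem_sup, sup_comm]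
  exact h n

/-- If `(R, 𝔪)` is a Noetherian local ring with residue field `k`, `S` is an `R`-algebra
with `Tor_1^R(S, k) = 0` and `𝔪S ≠ S`, then `Spec S → Spec R` is surjective: every
prime of `R` is the contraction of a prime of `S`. -/
theorem tor_one_vanishing_spec_surjective
    (R : Type) [CommRing R] [IsNoetherianRing R] [IsLocalRing R]
    (S : Type) [CommRing S] [Algebra R S]
    (htor : Subsingleton (TorGrp R 1 S (IsLocalRing.ResidueField R)))
    (hmS : Ideal.map (algebraMap R S) (IsLocalRing.maximalIdeal R) ≠ ⊤) :
    ∀ p : Ideal R, p.IsPrime →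
      ∃ q : Ideal S, q.IsPrime ∧ Ideal.comap (algebraMap R S) q = p := by
  intro p hp
  rw [← Ideal.comap_map_eq_self_iff_of_isPrime]
  refine le_antisymm (fun s hs ↦ ?_) Ideal.le_comap_map
  have hk := LTensorKernelsInjective.of_subsingleton_torGrp htor
  exact IsLocalRing.mem_of_forall_mem_sup_maximalIdeal_pow fun n ↦
    hk.comap_map_le hmS le_sup_right (Ideal.comap_mono (Ideal.map_mono le_sup_left) hs)
end

section
/- Let A be a commutative ring, 𝔞 an ideal of A, and let M and N be A-modules. If 𝔞N = 0 and Tor_1^A(M, N) = 0, then Tor_1^{A/𝔞}(M/𝔞M, N) = 0, where N is regarded as an A/𝔞-module. -/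
set_option synthInstance.maxHeartbeats 1000000
set_option maxHeartbeats 1000000
set_option linter.unusedVariables false

open CategoryTheory

open TensorProduct in
/-- If tensoring with `M` preserves injectivity of the inclusion of the kernel of some surjection
from a projective module onto `N`, then it does so for every surjection onto `N`. -/
theorem lTensor_ker_subtype_injective_of_projective {R M N P Q : Type*} [CommRing R]
    [AddCommGroup M] [Module R M] [AddCommGroup N] [Module R N]
    [AddCommGroup P] [Module R P] [Module.Projective R P] [AddCommGroup Q] [Module R Q]
    (f : P →ₗ[R] N) (hf : Function.Surjective f) (g : Q →ₗ[R] N) (hg : Function.Surjective g)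
    (h : Function.Injective ((LinearMap.ker f).subtype.lTensor M)) :
    Function.Injective ((LinearMap.ker g).subtype.lTensor M) := by
  obtain ⟨φ, hφ⟩ := Module.projective_lifting_property g f hg
  have hφ' (p : P) : g (φ p) = f p := LinearMap.congr_fun hφ p
  let φK : LinearMap.ker f →ₗ[R] LinearMap.ker g :=
    φ.restrict fun p hp ↦ by simpa [hφ'] using hp
  let j : LinearMap.ker f →ₗ[R] P × LinearMap.ker g := (LinearMap.ker f).subtype.prod (-φK)
  let s : P × LinearMap.ker g →ₗ[R] Q := φ.coprod (LinearMap.ker g).subtype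
  have hs : Function.Surjective s := fun q ↦ by
    obtain ⟨p, hp⟩ := hf (g q)
    exact ⟨(p, ⟨q - φ p, by simp [hφ', hp]⟩), by simp [s]⟩
  have hjs : Function.Exact j s := by
    rintro ⟨p, l, hl⟩
    constructor
    · intro hpl
      have hpl' : φ p + l = 0 := hpl
      have hp : f p = 0 := by
        rw [← hφ', eq_neg_of_add_eq_zero_left hpl', map_neg, LinearMap.mem_ker.1 hl, neg_zero]
      refine ⟨⟨p, hp⟩, Prod.ext rfl (Subtype.ext ?_)⟩
      exact neg_eq_of_add_eq_zero_right hpl'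
    · rintro ⟨k, hk⟩
      rw [← hk]
      simp [s, j, φK]
  rw [injective_iff_map_eq_zero]
  intro x hx
  have hx' : s.lTensor M ((LinearMap.inr R P _).lTensor M x) = 0 := by
    rw [← LinearMap.lTensor_comp_apply]
    simpa [s] using hx
  obtain ⟨y, hy⟩ := (lTensor_exact M hjs hs _).1 hx'
  have hy0 : y = 0 := by
    apply (injective_iff_map_eq_zero _).1 h
    have := congrArg ((LinearMap.fst R P _).lTensor M) hy
    simpa [← LinearMap.lTensor_comp_apply, j] using this
  have := congrArg ((LinearMap.snd R P (LinearMap.ker g)).lTensor M) hy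
  simpa [← LinearMap.lTensor_comp_apply, hy0] using this.symm

open TensorProduct in
/-- For modules `L` over `A ⧸ I`, the canonical map `M ⊗[A] L → (M ⧸ I M) ⊗[A ⧸ I] L`. -/
noncomputable def tensorToQuotTensor {A : Type*} [CommRing A] (I : Ideal A)
    (M L : Type*) [AddCommGroup M] [Module A M] [AddCommGroup L] [Module A L] [Module (A ⧸ I) L]
    [IsScalarTower A (A ⧸ I) L] :
    M ⊗[A] L →ₗ[A] (M ⧸ (I • ⊤ : Submodule A M)) ⊗[A ⧸ I] L :=
  mapOfCompatibleSMul (A ⧸ I) A A _ L ∘ₗ (I • ⊤ : Submodule A M).mkQ.rTensor L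

open TensorProduct in
theorem tensorToQuotTensor_bijective {A : Type*} [CommRing A] (I : Ideal A)
    (M L : Type*) [AddCommGroup M] [Module A M] [AddCommGroup L] [Module A L] [Module (A ⧸ I) L]
    [IsScalarTower A (A ⧸ I) L] :
    Function.Bijective (tensorToQuotTensor I M L) := by
  have : CompatibleSMul A (A ⧸ I) (M ⧸ (I • ⊤ : Submodule A M)) L :=
    .of_algebraMap_surjective _ _ Ideal.Quotient.mk_surjective
  refine Function.Bijective.comp
    (g := equivOfCompatibleSMul (A ⧸ I) A A (M ⧸ (I • ⊤ : Submodule A M)) L)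
    (f := (I • ⊤ : Submodule A M).mkQ.rTensor L) (LinearEquiv.bijective _) ⟨?_, ?_⟩
  · have hex := rTensor_exact L (LinearMap.exact_subtype_mkQ (I • ⊤ : Submodule A M))
      (Submodule.mkQ_surjective _)
    have hI (a : A) (ha : a ∈ I) (l : L) : a • l = 0 := by
      rw [← algebraMap_smul (A ⧸ I), Ideal.Quotient.algebraMap_eq,
        Ideal.Quotient.eq_zero_iff_mem.2 ha, zero_smul]
    have h0 (m : M) (hm : m ∈ (I • ⊤ : Submodule A M)) (l : L) : m ⊗ₜ[A] l = 0 := by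
      induction hm using Submodule.smul_induction_on' with
      | smul a ha m _ => rw [smul_tmul, hI a ha, tmul_zero]
      | add x _ y _ hx hy => rw [add_tmul, hx, hy, add_zero]
    have hzero : (I • ⊤ : Submodule A M).subtype.rTensor L = 0 := by
      ext m l
      exact h0 m m.2 l
    rw [injective_iff_map_eq_zero]
    intro x hx
    obtain ⟨y, rfl⟩ := (hex x).1 hx
    rw [hzero, LinearMap.zero_apply]
  · exact LinearMap.rTensor_surjective L (Submodule.mkQ_surjective _)

open TensorProduct in
theorem tensorToQuotTensor_lTensor {A : Type*} [CommRing A] (I : Ideal A)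
    (M : Type*) [AddCommGroup M] [Module A M]
    {L L' : Type*} [AddCommGroup L] [Module A L] [Module (A ⧸ I) L] [IsScalarTower A (A ⧸ I) L]
    [AddCommGroup L'] [Module A L'] [Module (A ⧸ I) L'] [IsScalarTower A (A ⧸ I) L']
    (f : L →ₗ[A ⧸ I] L') (x : M ⊗[A] L) :
    tensorToQuotTensor I M L' ((f.restrictScalars A).lTensor M x) =
      f.lTensor _ (tensorToQuotTensor I M L x) := by
  induction x with
  | zero => simp
  | add x y hx hy => simp only [map_add, hx, hy]
  | tmul m l => rfl

/-- `Tor₁(M, N)` vanishes if and only if tensoring with `M` preserves injectivity of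
`ker(P₀ → N) → P₀`, for `P` a projective resolution of `N`. -/
theorem subsingleton_torGrp_one_iff {R : Type} [CommRing R] (M N : Type)
    [AddCommGroup M] [Module R M] [AddCommGroup N] [Module R N]
    (P : ProjectiveResolution (ModuleCat.of R N)) :
    Subsingleton (TorGrp R 1 M N) ↔
      Function.Injective ((LinearMap.ker (P.π.f 0).hom).subtype.lTensor M) := by
  let d₁ : P.complex.X 1 →ₗ[R] P.complex.X 0 := (P.complex.d 1 0).hom
  let d₂ : P.complex.X 2 →ₗ[R] P.complex.X 1 := (P.complex.d 2 1).hom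
  have hex₁ : Function.Exact d₂ d₁ :=
    (ShortComplex.ShortExact.moduleCat_exact_iff_function_exact _).1 (P.exact_succ 0)
  have hex₀ : Function.Exact d₁ (P.π.f 0).hom :=
    (ShortComplex.ShortExact.moduleCat_exact_iff_function_exact _).1 P.exact₀
  have htor : Subsingleton (TorGrp R 1 M N) ↔
      Function.Exact (d₂.lTensor M) (d₁.lTensor M) := by
    rw [← ModuleCat.isZero_iff_subsingleton]
    refine (P.isoLeftDerivedObj _ 1).isZero_iff.trans ?_
    refine (HomologicalComplex.exactAt_iff_isZero_homology _ 1).symm.trans ?_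
    rw [HomologicalComplex.exactAt_iff' _ 2 1 0 (by simp) (by simp)]
    exact ShortComplex.ShortExact.moduleCat_exact_iff_function_exact _
  let e : P.complex.X 1 →ₗ[R] LinearMap.ker (P.π.f 0).hom :=
    d₁.codRestrict _ fun x ↦ hex₀.apply_apply_eq_zero x
  have he : Function.Surjective e := fun ⟨y, hy⟩ ↦ by
    obtain ⟨x, hx⟩ := (hex₀ y).1 hy
    exact ⟨x, Subtype.ext hx⟩
  have hexe : Function.Exact d₂ e := fun x ↦ by
    rw [← hex₁ x, Subtype.ext_iff]
    rfl
  have hcomp (x) : d₁.lTensor M x =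
      (LinearMap.ker (P.π.f 0).hom).subtype.lTensor M (e.lTensor M x) := by
    rw [← LinearMap.lTensor_comp_apply]
    rfl
  have htens := lTensor_exact M hexe he
  rw [htor, injective_iff_map_eq_zero]
  constructor
  · intro h x hx
    obtain ⟨y, rfl⟩ := LinearMap.lTensor_surjective M he x
    exact (htens y).2 ((h y).1 (by rw [hcomp, hx]))
  · intro h x
    rw [← htens x, hcomp]
    exact ⟨h _, fun hx ↦ by rw [hx, map_zero]⟩

/-- Let `A` be a ring, `𝔞` an ideal of `A`, `M` and `N` two `A`-modules with `𝔞N = 0`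
(so that `N` is an `A/𝔞`-module). If `Tor_1^A(M, N) = 0`, then
`Tor_1^{A/𝔞}(M/𝔞M, N) = 0`. -/
theorem tor_one_vanishing_of_quotient
    (A : Type) [CommRing A] (𝔞 : Ideal A)
    (M : Type) [AddCommGroup M] [Module A M]
    (N : Type) [AddCommGroup N] [Module A N] [Module (A ⧸ 𝔞) N]
    [IsScalarTower A (A ⧸ 𝔞) N]
    (hN : ∀ a ∈ 𝔞, ∀ x : N, a • x = 0)
    (htor : Subsingleton (TorGrp A 1 M N)) :
    Subsingleton (TorGrp (A ⧸ 𝔞) 1 (M ⧸ (𝔞 • ⊤ : Submodule A M)) N) := by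
  let P := projectiveResolution (ModuleCat.of A N)
  let Q := projectiveResolution (ModuleCat.of (A ⧸ 𝔞) N)
  have hP : Function.Surjective (P.π.f 0).hom := (ModuleCat.epi_iff_surjective _).1 inferInstance
  have hQ : Function.Surjective (Q.π.f 0).hom := (ModuleCat.epi_iff_surjective _).1 inferInstance
  have : Module.Projective A (P.complex.X 0) :=
    (IsProjective.iff_projective _).2 (P.projective 0)
  let _ : Module A (Q.complex.X 0) := Module.compHom _ (algebraMap A (A ⧸ 𝔞))
  have : IsScalarTower A (A ⧸ 𝔞) (Q.complex.X 0) := .of_algebraMap_smul fun _ _ ↦ rfl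
  let g : Q.complex.X 0 →ₗ[A ⧸ 𝔞] N := (Q.π.f 0).hom
  have key : Function.Injective ((LinearMap.ker (g.restrictScalars A)).subtype.lTensor M) :=
    lTensor_ker_subtype_injective_of_projective (P.π.f 0).hom hP _ hQ
      ((subsingleton_torGrp_one_iff M N P).1 htor)
  refine (subsingleton_torGrp_one_iff _ N Q).2 ?_
  change Function.Injective ((LinearMap.ker g).subtype.lTensor _)
  rw [injective_iff_map_eq_zero]
  intro x hx
  obtain ⟨y, rfl⟩ := (tensorToQuotTensor_bijective 𝔞 M (LinearMap.ker g)).2 x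
  rw [← tensorToQuotTensor_lTensor] at hx
  have hy := (injective_iff_map_eq_zero _).1 (tensorToQuotTensor_bijective 𝔞 M _).1 _ hx
  have hy0 : y = 0 := (injective_iff_map_eq_zero _).1 key y hy
  rw [hy0, map_zero]
end

section
/- Let (R, 𝔪) be a Noetherian local Cohen–Macaulay ring with residue field k = R/𝔪, and let S be a big Cohen–Macaulay R-algebra. If Tor_j^R(S, k) = 0 for some j ≥ 1, then Tor_n^R(S, k) = 0 for all n ≥ 1. -/
set_option synthInstance.maxHeartbeats 1000000
set_option maxHeartbeats 1000000
set_option linter.unusedVariables false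

open CategoryTheory

namespace TorRigidity

open CategoryTheory Limits MonoidalCategory TensorProduct

section LongExactSequence

variable {R : Type} [CommRing R]

/-- The complex `A ⊗ P` for the chosen projective resolution `P` of `M`. -/
noncomputable abbrev torComplex (A M : ModuleCat.{0} R) : ChainComplex (ModuleCat.{0} R) ℕ :=
  (((tensoringLeft (ModuleCat.{0} R)).obj A).mapHomologicalComplex _).obj
    (projectiveResolution M).complex

/-- The map of complexes `A ⊗ P ⟶ B ⊗ P` induced by `A ⟶ B`. -/
noncomputable abbrev torComplexMap {A B : ModuleCat.{0} R} (f : A ⟶ B) (M : ModuleCat.{0} R) :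
    torComplex A M ⟶ torComplex B M :=
  (NatTrans.mapHomologicalComplex ((tensoringLeft (ModuleCat.{0} R)).map f) _).app
    (projectiveResolution M).complex

lemma subsingleton_torGrp_iff_isZero_homology (n : ℕ) (A M : Type) [AddCommGroup A] [Module R A]
    [AddCommGroup M] [Module R M] :
    Subsingleton (TorGrp R n A M) ↔
      IsZero ((torComplex (ModuleCat.of R A) (ModuleCat.of R M)).homology n) := by
  rw [← ModuleCat.isZero_iff_subsingleton]
  exact Iso.isZero_iff ((projectiveResolution (ModuleCat.of R M)).isoLeftDerivedObj
    ((tensoringLeft (ModuleCat.{0} R)).obj (ModuleCat.of R A)) n)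

/-- The short complex of complexes `S ⊗ P`. -/
noncomputable def torShortComplex (S : ShortComplex (ModuleCat.{0} R)) (M : ModuleCat.{0} R) :
    ShortComplex (ChainComplex (ModuleCat.{0} R) ℕ) :=
  ShortComplex.mk (torComplexMap S.f M) (torComplexMap S.g M) (by
    ext i : 1
    change S.f ▷ _ ≫ S.g ▷ _ = 0
    rw [← MonoidalCategory.comp_whiskerRight, S.zero, MonoidalPreadditive.zero_whiskerRight])

lemma torShortComplex_shortExact {S : ShortComplex (ModuleCat.{0} R)} (hS : S.ShortExact)
    (M : ModuleCat.{0} R) : (torShortComplex S M).ShortExact := by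
  refine HomologicalComplex.shortExact_of_degreewise_shortExact _ fun i => ?_
  have : Module.Projective R ((projectiveResolution M).complex.X i) :=
    (IsProjective.iff_projective _).mpr ((projectiveResolution M).projective i)
  exact hS.map_of_exact (tensorRight ((projectiveResolution M).complex.X i))

lemma subsingleton_torGrp_of_flat (n : ℕ) (Q M : Type) [AddCommGroup Q] [Module R Q]
    [Module.Flat R Q] [AddCommGroup M] [Module R M] :
    Subsingleton (TorGrp R (n + 1) Q M) := by
  rw [subsingleton_torGrp_iff_isZero_homology, ← HomologicalComplex.exactAt_iff_isZero_homology]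
  have h := (projectiveResolution (ModuleCat.of R M)).exact_succ n
  rw [HomologicalComplex.exactAt_iff' _ (n + 2) (n + 1) n (by simp) (by simp)]
  exact Module.Flat.lTensor_shortComplex_exact (ModuleCat.of R Q) _ h

lemma mono_homologyMap_zero_iff {A B : ModuleCat.{0} R} (f : A ⟶ B) (M : ModuleCat.{0} R) :
    Mono (HomologicalComplex.homologyMap (torComplexMap f M) 0) ↔ Mono (f ▷ M) := by
  let P := projectiveResolution M
  let e (A : ModuleCat.{0} R) : (torComplex A M).homology 0 ≅ A ⊗ M :=
    ChainComplex.isoHomologyι₀ _ ≪≫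
      asIso (P.fromLeftDerivedZero' ((tensoringLeft (ModuleCat.{0} R)).obj A))
  have comm : HomologicalComplex.homologyMap (torComplexMap f M) 0 ≫ (e B).hom =
      (e A).hom ≫ f ▷ M := by
    simp only [e, Iso.trans_hom, asIso_hom, Category.assoc]
    refine (HomologicalComplex.homologyι_naturality_assoc (torComplexMap f M) 0 _).trans ?_
    refine congrArg (HomologicalComplex.homologyι (torComplex A M) 0 ≫ ·) ?_
    rw [← cancel_epi (HomologicalComplex.pOpcycles _ _), HomologicalComplex.p_opcyclesMap_assoc,
      ProjectiveResolution.pOpcycles_comp_fromLeftDerivedZero',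
      ProjectiveResolution.pOpcycles_comp_fromLeftDerivedZero'_assoc]
    exact (whisker_exchange f (P.π.f 0)).symm
  exact (MorphismProperty.monomorphisms _).arrow_mk_iso_iff (Arrow.isoMk (e A) (e B) comm.symm)

variable {Z Q A : Type} [AddCommGroup Z] [Module R Z] [AddCommGroup Q] [Module R Q]
  [Module.Flat R Q] [AddCommGroup A] [Module R A]

lemma subsingleton_torGrp_one_iff {f : Z →ₗ[R] Q} {g : Q →ₗ[R] A}
    (hf : Function.Injective f) (hfg : Function.Exact f g) (hg : Function.Surjective g)
    (M : Type) [AddCommGroup M] [Module R M] :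
    Subsingleton (TorGrp R 1 A M) ↔ Function.Injective (f.rTensor M) := by
  let S : ShortComplex (ModuleCat.{0} R) := ModuleCat.shortComplexOfCompEqZero f g
    hfg.linearMap_comp_eq_zero
  have hS : S.ShortExact := ModuleCat.shortComplex_shortExact S hfg hf hg
  have hT := torShortComplex_shortExact hS (ModuleCat.of R M)
  have h0 := (subsingleton_torGrp_iff_isZero_homology _ _ _).mp
    (subsingleton_torGrp_of_flat (R := R) 0 Q M)
  have hrel : (ComplexShape.down ℕ).Rel 1 0 := by simp
  have hmono : Mono (hT.δ 1 0 hrel) := hT.mono_δ 1 0 hrel h0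
  have key : Function.Injective (f.rTensor M) ↔
      Mono (HomologicalComplex.homologyMap (torShortComplex S (ModuleCat.of R M)).f 0) := by
    refine Iff.trans ?_ (mono_homologyMap_zero_iff S.f (ModuleCat.of R M)).symm
    rw [ModuleCat.mono_iff_injective]
    rfl
  rw [subsingleton_torGrp_iff_isZero_homology, key]
  have ex := hT.homology_exact₁ 1 0 hrel
  constructor
  · intro h
    exact ex.mono_g (h.eq_of_src _ _)
  · intro h
    exact @IsZero.of_mono_eq_zero _ _ _ _ _ _ hmono (ex.mono_g_iff.mp h)

lemma subsingleton_torGrp_add_two_iff {f : Z →ₗ[R] Q} {g : Q →ₗ[R] A}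
    (hf : Function.Injective f) (hfg : Function.Exact f g) (hg : Function.Surjective g)
    (n : ℕ) (M : Type) [AddCommGroup M] [Module R M] :
    Subsingleton (TorGrp R (n + 2) A M) ↔ Subsingleton (TorGrp R (n + 1) Z M) := by
  let S : ShortComplex (ModuleCat.{0} R) := ModuleCat.shortComplexOfCompEqZero f g
    hfg.linearMap_comp_eq_zero
  have hS : S.ShortExact := ModuleCat.shortComplex_shortExact S hfg hf hg
  have hT := torShortComplex_shortExact hS (ModuleCat.of R M)
  have h0 (n : ℕ) := (subsingleton_torGrp_iff_isZero_homology _ _ _).mp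
    (subsingleton_torGrp_of_flat (R := R) n Q M)
  rw [subsingleton_torGrp_iff_isZero_homology, subsingleton_torGrp_iff_isZero_homology]
  exact (hT.δIso (n + 2) (n + 1) (by simp) (h0 _) (h0 _)).isZero_iff

end LongExactSequence

section SecondVariable

variable {R : Type} [CommRing R]

lemma exists_flat_presentation (A : Type) [AddCommGroup A] [Module R A] :
    ∃ (Z Q : Type) (_ : AddCommGroup Z) (_ : Module R Z) (_ : AddCommGroup Q) (_ : Module R Q)
      (_ : Module.Flat R Q) (f : Z →ₗ[R] Q) (g : Q →ₗ[R] A),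
      Function.Injective f ∧ Function.Exact f g ∧ Function.Surjective g :=
  ⟨LinearMap.ker (Finsupp.linearCombination R (id : A → A)), A →₀ R, inferInstance, inferInstance,
    inferInstance, inferInstance, inferInstance, Submodule.subtype _,
    Finsupp.linearCombination R (id : A → A), Submodule.subtype_injective _,
    LinearMap.exact_subtype_ker_map _, Finsupp.linearCombination_id_surjective R A⟩

lemma rTensor_lTensor_comm {A B M N : Type} [AddCommGroup A] [Module R A] [AddCommGroup B]
    [Module R B] [AddCommGroup M] [Module R M] [AddCommGroup N] [Module R N] (f : A →ₗ[R] B)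
    (u : M →ₗ[R] N) (x : A ⊗[R] M) :
    f.rTensor N (u.lTensor A x) = u.lTensor B (f.rTensor M x) := by
  rw [← LinearMap.comp_apply, ← LinearMap.comp_apply, LinearMap.rTensor_comp_lTensor,
    LinearMap.lTensor_comp_rTensor]

lemma subsingleton_torGrp_congr {M N : Type} [AddCommGroup M] [Module R M] [AddCommGroup N]
    [Module R N] (e : M ≃ₗ[R] N) (n : ℕ) (A : Type) [AddCommGroup A] [Module R A]
    (h : Subsingleton (TorGrp R n A M)) : Subsingleton (TorGrp R n A N) := by
  rw [← ModuleCat.isZero_iff_subsingleton] at h ⊢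
  exact h.of_iso ((((Tor (ModuleCat R) n).obj (ModuleCat.of R A))).mapIso e.toModuleIso).symm

variable {B' B B'' : Type} [AddCommGroup B'] [Module R B'] [AddCommGroup B] [Module R B]
  [AddCommGroup B''] [Module R B''] {u : B' →ₗ[R] B} {v : B →ₗ[R] B''}

lemma subsingleton_torGrp_one_quotient (huv : Function.Exact u v) (hv : Function.Surjective v)
    (A : Type) [AddCommGroup A] [Module R A] (hinj : Function.Injective (u.lTensor A))
    (h : Subsingleton (TorGrp R 1 A B)) : Subsingleton (TorGrp R 1 A B'') := by
  obtain ⟨Z, Q, _, _, _, _, _, f, g, hf, hfg, hg⟩ := exists_flat_presentation (R := R) A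
  rw [subsingleton_torGrp_one_iff hf hfg hg] at h ⊢
  rw [injective_iff_map_eq_zero]
  intro z'' hz''
  obtain ⟨z, rfl⟩ := LinearMap.lTensor_surjective Z hv z''
  rw [rTensor_lTensor_comm] at hz''
  obtain ⟨q', hq'⟩ := (lTensor_exact Q huv hv _).mp hz''
  have hq : g.rTensor B' q' = 0 := by
    apply hinj
    rw [← rTensor_lTensor_comm, hq', map_zero]
    exact (rTensor_exact B hfg hg).apply_apply_eq_zero z
  obtain ⟨z', rfl⟩ := (rTensor_exact B' hfg hg _).mp hq
  rw [← rTensor_lTensor_comm] at hq'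
  rw [← h hq']
  exact (lTensor_exact Z huv hv).apply_apply_eq_zero z'

lemma lTensor_injective_of_subsingleton_torGrp_one (hu : Function.Injective u)
    (huv : Function.Exact u v) (hv : Function.Surjective v)
    (A : Type) [AddCommGroup A] [Module R A]
    (h : Subsingleton (TorGrp R 1 A B'')) : Function.Injective (u.lTensor A) := by
  obtain ⟨Z, Q, _, _, _, _, _, f, g, hf, hfg, hg⟩ := exists_flat_presentation (R := R) A
  rw [subsingleton_torGrp_one_iff hf hfg hg] at h
  rw [injective_iff_map_eq_zero]
  intro a' ha'
  obtain ⟨q', rfl⟩ := LinearMap.rTensor_surjective B' hg a'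
  rw [← rTensor_lTensor_comm] at ha'
  obtain ⟨z, hz⟩ := (rTensor_exact B hfg hg _).mp ha'
  have hvz : v.lTensor Z z = 0 := by
    apply h
    rw [rTensor_lTensor_comm, hz, map_zero]
    exact (lTensor_exact Q huv hv).apply_apply_eq_zero q'
  obtain ⟨z', rfl⟩ := (lTensor_exact Z huv hv _).mp hvz
  rw [rTensor_lTensor_comm] at hz
  rw [← Module.Flat.lTensor_preserves_injective_linearMap (M := Q) u hu hz]
  exact (rTensor_exact B' hfg hg).apply_apply_eq_zero z'

lemma subsingleton_torGrp_one_extension (hu : Function.Injective u)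
    (huv : Function.Exact u v) (hv : Function.Surjective v)
    (A : Type) [AddCommGroup A] [Module R A] (h' : Subsingleton (TorGrp R 1 A B'))
    (h'' : Subsingleton (TorGrp R 1 A B'')) : Subsingleton (TorGrp R 1 A B) := by
  obtain ⟨Z, Q, _, _, _, _, _, f, g, hf, hfg, hg⟩ := exists_flat_presentation (R := R) A
  rw [subsingleton_torGrp_one_iff hf hfg hg] at h' h'' ⊢
  rw [injective_iff_map_eq_zero]
  intro z hz
  have hvz : v.lTensor Z z = 0 := by
    apply h''
    rw [rTensor_lTensor_comm, hz, map_zero, map_zero]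
  obtain ⟨z', rfl⟩ := (lTensor_exact Z huv hv _).mp hvz
  rw [rTensor_lTensor_comm] at hz
  rw [(injective_iff_map_eq_zero _).mp h' z' <| (injective_iff_map_eq_zero _).mp
    (Module.Flat.lTensor_preserves_injective_linearMap (M := Q) u hu) _ hz, map_zero]

/-- `Tor` vanishes on an extension if it vanishes on the outer terms. -/
lemma subsingleton_torGrp_extension (hu : Function.Injective u)
    (huv : Function.Exact u v) (hv : Function.Surjective v) (n : ℕ)
    (A : Type) [AddCommGroup A] [Module R A] (h' : Subsingleton (TorGrp R (n + 1) A B'))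
    (h'' : Subsingleton (TorGrp R (n + 1) A B'')) : Subsingleton (TorGrp R (n + 1) A B) := by
  induction n generalizing A with
  | zero => exact subsingleton_torGrp_one_extension hu huv hv A h' h''
  | succ n ih =>
    obtain ⟨Z, Q, _, _, _, _, _, f, g, hf, hfg, hg⟩ := exists_flat_presentation (R := R) A
    rw [subsingleton_torGrp_add_two_iff hf hfg hg] at h' h'' ⊢
    exact ih Z h' h''

lemma subsingleton_torGrp_quotient (hu : Function.Injective u)
    (huv : Function.Exact u v) (hv : Function.Surjective v) (n : ℕ)
    (A : Type) [AddCommGroup A] [Module R A] (h' : Subsingleton (TorGrp R (n + 1) A B'))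
    (h : Subsingleton (TorGrp R (n + 2) A B)) : Subsingleton (TorGrp R (n + 2) A B'') := by
  induction n generalizing A with
  | zero =>
    obtain ⟨Z, Q, _, _, _, _, _, f, g, hf, hfg, hg⟩ := exists_flat_presentation (R := R) A
    rw [subsingleton_torGrp_add_two_iff hf hfg hg] at h ⊢
    rw [subsingleton_torGrp_one_iff hf hfg hg] at h'
    refine subsingleton_torGrp_one_quotient huv hv Z ?_ h
    refine Function.Injective.of_comp (f := f.rTensor B) ?_
    rw [← LinearMap.coe_comp, LinearMap.rTensor_comp_lTensor, ← LinearMap.lTensor_comp_rTensor]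
    exact (Module.Flat.lTensor_preserves_injective_linearMap (M := Q) u hu).comp h'
  | succ n ih =>
    obtain ⟨Z, Q, _, _, _, _, _, f, g, hf, hfg, hg⟩ := exists_flat_presentation (R := R) A
    rw [subsingleton_torGrp_add_two_iff hf hfg hg] at h h' ⊢
    exact ih Z h' h

lemma subsingleton_torGrp_sub (hu : Function.Injective u)
    (huv : Function.Exact u v) (hv : Function.Surjective v) (n : ℕ)
    (A : Type) [AddCommGroup A] [Module R A] (h : Subsingleton (TorGrp R (n + 1) A B))
    (h'' : Subsingleton (TorGrp R (n + 2) A B'')) : Subsingleton (TorGrp R (n + 1) A B') := by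
  induction n generalizing A with
  | zero =>
    obtain ⟨Z, Q, _, _, _, _, _, f, g, hf, hfg, hg⟩ := exists_flat_presentation (R := R) A
    rw [subsingleton_torGrp_add_two_iff hf hfg hg] at h''
    rw [subsingleton_torGrp_one_iff hf hfg hg] at h ⊢
    refine Function.Injective.of_comp (f := u.lTensor Q) ?_
    rw [← LinearMap.coe_comp, LinearMap.lTensor_comp_rTensor, ← LinearMap.rTensor_comp_lTensor]
    exact h.comp (lTensor_injective_of_subsingleton_torGrp_one hu huv hv Z h'')
  | succ n ih =>
    obtain ⟨Z, Q, _, _, _, _, _, f, g, hf, hfg, hg⟩ := exists_flat_presentation (R := R) A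
    rw [subsingleton_torGrp_add_two_iff hf hfg hg] at h h'' ⊢
    exact ih Z h h''

end SecondVariable

open IsLocalRing RingTheory.Sequence Pointwise

section Annihilator

variable {R : Type} [CommRing R]

lemma annihilator_sup_span_le_annihilator_quotSMulTop (x : R) (M : Type) [AddCommGroup M]
    [Module R M] : Ideal.ofList [x] ⊔ Module.annihilator R M ≤
      Module.annihilator R (QuotSMulTop x M) := by
  refine sup_le ?_ ?_
  · simpa [Ideal.ofList_singleton, Ideal.span_le] using QuotSMulTop.mem_annihilator M x
  · exact LinearMap.annihilator_le_of_surjective (Submodule.mkQ _) (Submodule.mkQ_surjective _)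

lemma ofList_cons_sup_annihilator_le (x : R) (xs : List R) (M : Type) [AddCommGroup M]
    [Module R M] : Ideal.ofList (x :: xs) ⊔ Module.annihilator R M ≤
      Ideal.ofList xs ⊔ Module.annihilator R (QuotSMulTop x M) := by
  have := annihilator_sup_span_le_annihilator_quotSMulTop x M
  rw [Ideal.ofList_singleton] at this
  rw [Ideal.ofList_cons, sup_comm (Ideal.span {x}), sup_assoc]
  exact sup_le_sup_left this _

end Annihilator

section Depth

variable {R : Type} [CommRing R] [IsNoetherianRing R] [IsLocalRing R]

lemma length_le_ringKrullDim_quotient_of_isAssociatedPrime (rs : List R) (M : Type)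
    [AddCommGroup M] [Module R M] [Module.Finite R M] (hrs : ∀ r ∈ rs, r ∈ maximalIdeal R)
    (h : IsWeaklyRegular M rs) (p : Ideal R) (hp : IsAssociatedPrime p M) :
    (rs.length : WithBot ℕ∞) ≤ ringKrullDim (R ⧸ p) := by
  induction rs generalizing M p with
  | nil =>
    have := hp.isPrime
    simpa using ringKrullDim_nonneg_of_nontrivial
  | cons y ys ih =>
    rw [isWeaklyRegular_cons_iff] at h
    simp only [List.mem_cons, forall_eq_or_imp] at hrs
    have hpp := hp.isPrime
    obtain ⟨-, m, hm⟩ := isAssociatedPrime_iff.mp hp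
    let N : Submodule R M := Submodule.torsionBySet R M p
    have hmN : m ∈ N := by
      rw [Submodule.mem_torsionBySet_iff]
      rintro ⟨a, ha⟩
      simpa [hm] using ha
    have hm0 : m ≠ 0 := by
      rintro rfl
      exact hpp.ne_top (by simp [hm])
    have hN : ¬ N ≤ y • (⊤ : Submodule R M) := by
      intro hle
      have hle' : N ≤ maximalIdeal R • N := by
        intro n hn
        obtain ⟨m', -, rfl⟩ := (Submodule.mem_smul_pointwise_iff_exists _ _ _).mp (hle hn)
        refine Submodule.smul_mem_smul hrs.1 ?_
        rw [Submodule.mem_torsionBySet_iff] at hn ⊢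
        intro a
        refine h.1 ?_
        simpa [smul_comm y] using hn a
      have : N = ⊥ := Submodule.eq_bot_of_le_smul_of_le_jacobson_bot _ N
        (IsNoetherian.noetherian N) hle' (by rw [jacobson_eq_maximalIdeal _ bot_ne_top])
      rw [this] at hmN
      exact hm0 hmN
    obtain ⟨n, hnN, hn⟩ := Set.not_subset.mp hN
    obtain ⟨q, hq, hqn⟩ := exists_le_isAssociatedPrime_of_isNoetherianRing R
      (Submodule.Quotient.mk n : QuotSMulTop y M) (by
        rwa [ne_eq, Submodule.Quotient.mk_eq_zero])
    have hqp := hq.isPrime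
    have hpq : p ≤ q := by
      refine le_trans (fun a ha => ?_) hqn
      have : a • n = 0 := (Submodule.mem_torsionBySet_iff _ _).mp hnN ⟨a, ha⟩
      rw [Submodule.mem_colon_singleton, ← Submodule.Quotient.mk_smul, this]
      simp
    have hyq : y ∈ q := hq.annihilator_le (by
      rw [Submodule.annihilator_top]; exact QuotSMulTop.mem_annihilator M y)
    have hyp : y ∉ p := by
      intro hy
      refine hm0 (h.1 ?_)
      have := hm ▸ hy
      simpa using this
    have h1 := ih (QuotSMulTop y M) hrs.2 h.2 q hq
    have h2 := ringKrullDim_succ_le_of_surjective (Ideal.Quotient.factor hpq)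
      (Ideal.Quotient.factor_surjective hpq) (r := Ideal.Quotient.mk p y)
      (mem_nonZeroDivisors_of_ne_zero (by simpa [Ideal.Quotient.eq_zero_iff_mem] using hyp))
      (by simpa [Ideal.Quotient.eq_zero_iff_mem] using hyq)
    refine le_trans ?_ h2
    push_cast [List.length_cons]
    gcongr

lemma supportDim_le_length (xs : List R) (M : Type)
    [AddCommGroup M] [Module R M] [Module.Finite R M] (hxs : ∀ r ∈ xs, r ∈ maximalIdeal R)
    (h : maximalIdeal R ≤ (Ideal.ofList xs ⊔ Module.annihilator R M).radical) :
    Module.supportDim R M ≤ xs.length := by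
  induction xs generalizing M with
  | nil =>
    have : Subsingleton (Module.support R M) := by
      refine ⟨fun a b => Subtype.ext (PrimeSpectrum.ext ?_)⟩
      have key (a : Module.support R M) : a.1.asIdeal = maximalIdeal R := by
        refine ((maximalIdeal.isMaximal R).eq_of_le a.1.2.ne_top ?_).symm
        refine h.trans (a.1.2.radical_le_iff.mpr ?_)
        simpa using Module.mem_support_iff_of_finite.mp a.2
      rw [key a, key b]
    exact Order.krullDim_nonpos_of_subsingleton
  | cons x xs ih =>
    simp only [List.mem_cons, forall_eq_or_imp] at hxs
    have h1 := ih (QuotSMulTop x M) hxs.2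
      (h.trans (Ideal.radical_mono (ofList_cons_sup_annihilator_le x xs M)))
    refine (Module.supportDim_le_supportDim_quotSMulTop_succ hxs.1).trans ?_
    push_cast [List.length_cons]
    gcongr

open CategoryTheory Abelian in
lemma exists_isRegular_quotSMulTop (M : Type) [AddCommGroup M] [Module R M] [Module.Finite R M]
    [Nontrivial M] (rs : List R) (hrs : ∀ r ∈ rs, r ∈ maximalIdeal R) (h : IsRegular M rs)
    (n : ℕ) (hn : rs.length = n + 1)
    (x : R) (hx : x ∈ maximalIdeal R) (hxM : IsSMulRegular M x) :
    ∃ ys : List R, ys.length = n ∧ (∀ r ∈ ys, r ∈ maximalIdeal R) ∧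
      IsRegular (QuotSMulTop x M) ys := by
  have lt (L : Type) [AddCommGroup L] [Module R L] [Module.Finite R L] [Nontrivial L] :
      maximalIdeal R • (⊤ : Submodule R L) < ⊤ :=
    (Submodule.top_ne_ideal_smul_of_le_jacobson_annihilator
      (maximalIdeal_le_jacobson _)).symm.lt_top
  let K : ModuleCat.{0} R := ModuleCat.of R (R ⧸ maximalIdeal R)
  have hK : Module.support R K = PrimeSpectrum.zeroLocus (maximalIdeal R) := by
    rw [Module.support_eq_zeroLocus, Ideal.annihilator_quotient]
  have hExt := ModuleCat.subsingleton_ext_of_exists_isRegular (maximalIdeal R) K hK.subset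
    (ModuleCat.of R M) (lt M) rs hrs h
  have := nontrivial_quotSMulTop_of_mem_maximalIdeal M hx
  refine ModuleCat.exists_isRegular_of_exists_subsingleton_ext (maximalIdeal R) n
    (ModuleCat.of R (QuotSMulTop x M)) (lt _) K hK fun i hi => ?_
  have zero1 := AddCommGrpCat.isZero_of_iff_subsingleton.mpr (hExt i (by omega))
  have zero2 := AddCommGrpCat.isZero_of_iff_subsingleton.mpr (hExt (i + 1) (by omega))
  have hxM' : IsSMulRegular (ModuleCat.of R M) x := hxM
  exact AddCommGrpCat.subsingleton_of_isZero <| ShortComplex.Exact.isZero_of_both_zeros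
    ((Ext.covariant_sequence_exact₃' K hxM'.smulShortComplex_shortExact) i (i + 1) rfl)
    (zero1.eq_zero_of_src _) (zero2.eq_zero_of_tgt _)

lemma isWeaklyRegular_of_maximalIdeal_le_radical (xs : List R) (M : Type)
    [AddCommGroup M] [Module R M] [Module.Finite R M] [Nontrivial M]
    (hxs : ∀ r ∈ xs, r ∈ maximalIdeal R)
    (h : maximalIdeal R ≤ (Ideal.ofList xs ⊔ Module.annihilator R M).radical)
    (rs : List R) (hrs : ∀ r ∈ rs, r ∈ maximalIdeal R) (hreg : IsRegular M rs)
    (hlen : rs.length = xs.length) : IsWeaklyRegular M xs := by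
  induction xs generalizing M rs with
  | nil => exact IsWeaklyRegular.nil R M
  | cons x xs ih =>
    simp only [List.mem_cons, forall_eq_or_imp] at hxs
    have hxM : IsSMulRegular M x := by
      by_contra hx
      have hx' : x ∈ ⋃ p ∈ associatedPrimes R M, (p : Set R) := by
        rw [biUnion_associatedPrimes_eq_compl_regular]; exact hx
      simp only [Set.mem_iUnion, SetLike.mem_coe] at hx'
      obtain ⟨p, hp, hxp⟩ := hx'
      have hlow := length_le_ringKrullDim_quotient_of_isAssociatedPrime rs M hrs
        hreg.toIsWeaklyRegular p hp
      have hup := supportDim_le_length xs (R ⧸ p) hxs.2 (by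
        refine h.trans (Ideal.radical_mono ?_)
        have hann := hp.annihilator_le
        rw [Submodule.annihilator_top] at hann
        rw [Ideal.annihilator_quotient, Ideal.ofList_cons, sup_comm (Ideal.span {x}), sup_assoc]
        exact sup_le_sup_left (sup_le (by simpa [Ideal.span_le] using hxp) hann) _)
      rw [Module.supportDim_quotient_eq_ringKrullDim] at hup
      have := hlow.trans hup
      rw [hlen, List.length_cons] at this
      have h' : xs.length + 1 ≤ xs.length := by exact_mod_cast this
      omega
    rw [isWeaklyRegular_cons_iff]
    refine ⟨hxM, ?_⟩
    obtain ⟨ys, hys, hysm, hysr⟩ := exists_isRegular_quotSMulTop M rs hrs hreg xs.length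
      (by simpa using hlen) x hxs.1 hxM
    have := nontrivial_quotSMulTop_of_mem_maximalIdeal M hxs.1
    exact ih (QuotSMulTop x M) hxs.2
      (h.trans (Ideal.radical_mono (ofList_cons_sup_annihilator_le x xs M))) ys hysm hysr hys

lemma isWeaklyRegular_of_isSystemOfParameters {xs : List R} (hxs : IsSystemOfParameters R xs)
    (hCM : IsCohenMacaulayLocalRing R) : IsWeaklyRegular R xs := by
  obtain ⟨-, _, rs, hrs, hreg, hlen⟩ := hCM
  obtain ⟨hm, hxlen, hrad⟩ := hxs
  refine isWeaklyRegular_of_maximalIdeal_le_radical xs R hm ?_ rs hrs hreg ?_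
  · rw [← hrad]
    exact Ideal.radical_mono le_sup_left
  · exact_mod_cast hlen.trans hxlen.symm

end Depth

section TestModule

variable {R : Type} [CommRing R]

lemma subsingleton_torGrp_of_projective (n : ℕ) (A M : Type) [AddCommGroup A] [Module R A]
    [AddCommGroup M] [Module R M] [Module.Projective R M] :
    Subsingleton (TorGrp R (n + 1) A M) := by
  have : CategoryTheory.Projective (ModuleCat.of R M) :=
    (IsProjective.iff_projective M).mp inferInstance
  rw [← ModuleCat.isZero_iff_subsingleton]
  exact isZero_Tor_succ_of_projective (ModuleCat.{0} R) (ModuleCat.of R A) (ModuleCat.of R M) n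

lemma subsingleton_torGrp_quotSMulTop {x : R} {S M : Type} [AddCommGroup S] [Module R S]
    [AddCommGroup M] [Module R M] (hM : IsSMulRegular M x) (hSM : IsSMulRegular (S ⊗[R] M) x)
    (h : ∀ n, Subsingleton (TorGrp R (n + 1) S M)) (n : ℕ) :
    Subsingleton (TorGrp R (n + 1) S (QuotSMulTop x M)) := by
  have hexact := LinearMap.exact_lsmul_mkQ_smul_top M x
  have hsurj := Submodule.mkQ_surjective (x • (⊤ : Submodule R M))
  cases n with
  | zero =>
    refine subsingleton_torGrp_one_quotient hexact hsurj S ?_ (h 0)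
    have : (LinearMap.lsmul R M x).lTensor S = LinearMap.lsmul R (S ⊗[R] M) x := by
      ext; simp
    rw [this]
    exact hSM
  | succ n =>
    exact subsingleton_torGrp_quotient (u := LinearMap.lsmul R M x) hM hexact hsurj n S (h n)
      (h (n + 1))

lemma exists_torIndependent_of_isWeaklyRegular [IsNoetherianRing R] [IsLocalRing R]
    (S : Type) [AddCommGroup S] [Module R S] (rs : List R)
    (hrs : ∀ r ∈ rs, r ∈ maximalIdeal R) (M : Type) [AddCommGroup M] [Module R M]
    [Module.Finite R M] [Nontrivial M] (hM : IsWeaklyRegular M rs)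
    (hSM : IsWeaklyRegular (S ⊗[R] M) rs) (h : ∀ n, Subsingleton (TorGrp R (n + 1) S M)) :
    ∃ (A : Type) (_ : AddCommGroup A) (_ : Module R A), Module.Finite R A ∧ Nontrivial A ∧
      Ideal.ofList rs ⊔ Module.annihilator R M ≤ Module.annihilator R A ∧
      ∀ n, Subsingleton (TorGrp R (n + 1) S A) := by
  induction rs generalizing M with
  | nil => exact ⟨M, inferInstance, inferInstance, inferInstance, inferInstance, by simp, h⟩
  | cons x xs ih =>
    simp only [List.mem_cons, forall_eq_or_imp] at hrs
    rw [isWeaklyRegular_cons_iff] at hM hSM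
    have := nontrivial_quotSMulTop_of_mem_maximalIdeal M hrs.1
    obtain ⟨A, _, _, hfin, hnt, hann, htor⟩ := ih hrs.2 (QuotSMulTop x M) hM.2
      (((QuotSMulTop.tensorQuotSMulTopEquivQuotSMulTop x S M).isWeaklyRegular_congr xs).mpr hSM.2)
      (subsingleton_torGrp_quotSMulTop hM.1 hSM.1 h)
    exact ⟨A, _, _, hfin, hnt, (ofList_cons_sup_annihilator_le x xs M).trans hann, htor⟩

end TestModule

section LocalRing

variable {R : Type} [CommRing R] [IsLocalRing R]

lemma eq_maximalIdeal_of_mem_support {M : Type} [AddCommGroup M] [Module R M]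
    (hM : Module.support R M ⊆ {closedPoint R}) {p : Ideal R} [hp : p.IsPrime]
    (h : ⟨p, hp⟩ ∈ Module.support R M) : p = maximalIdeal R :=
  congrArg PrimeSpectrum.asIdeal (hM h)

lemma exists_surjective_to_residueField (A : Type) [AddCommGroup A] [Module R A]
    [Module.Finite R A] [Nontrivial A] :
    ∃ f : A →ₗ[R] R ⧸ maximalIdeal R, Function.Surjective f := by
  obtain ⟨N, hN, -⟩ := (eq_top_or_exists_le_coatom (⊥ : Submodule R A)).resolve_left bot_ne_top
  obtain ⟨I, hI, ⟨e⟩⟩ := isSimpleModule_iff_quot_maximal.mp (isSimpleModule_iff_isCoatom.mpr hN)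
  obtain rfl := eq_maximalIdeal hI
  exact ⟨e.toLinearMap ∘ₗ N.mkQ, e.surjective.comp N.mkQ_surjective⟩

end LocalRing

section Rigidity

variable {R : Type} [CommRing R] [IsNoetherianRing R] [IsLocalRing R]

lemma subsingleton_torGrp_of_support_subset (S : Type) [AddCommGroup S] [Module R S] (n : ℕ)
    (h : Subsingleton (TorGrp R (n + 1) S (R ⧸ maximalIdeal R)))
    (M : Type) [AddCommGroup M] [Module R M] [Module.Finite R M]
    (hM : Module.support R M ⊆ {closedPoint R}) : Subsingleton (TorGrp R (n + 1) S M) := by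
  induction ‹Module.Finite R M› using
    IsNoetherianRing.induction_on_isQuotientEquivQuotientPrime R with
  | subsingleton N => exact subsingleton_torGrp_of_projective n S N
  | quotient N p e =>
    have hp : p ∈ Module.support R N := by
      rw [e.support_eq, Module.support_eq_zeroLocus, Ideal.annihilator_quotient]
      exact le_refl p.asIdeal
    have hpm := eq_maximalIdeal_of_mem_support hM hp
    exact subsingleton_torGrp_congr (e.trans (Submodule.quotEquivOfEq _ _ hpm)).symm (n + 1) S h
  | exact N₁ N₂ N₃ f g hf hg hfg h₁ h₃ =>
    exact subsingleton_torGrp_extension hf hfg hg n S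
      (h₁ ((Module.support_subset_of_injective f hf).trans hM))
      (h₃ ((Module.support_subset_of_surjective g hg).trans hM))

lemma exists_injective_from_residueField (A : Type) [AddCommGroup A] [Module R A]
    [Module.Finite R A] [Nontrivial A] (hA : Module.support R A ⊆ {closedPoint R}) :
    ∃ f : (R ⧸ maximalIdeal R) →ₗ[R] A, Function.Injective f := by
  obtain ⟨p, hp⟩ := associatedPrimes.nonempty R A
  have hpp := hp.isPrime
  have hann := hp.annihilator_le
  rw [Submodule.annihilator_top] at hann
  obtain rfl := eq_maximalIdeal_of_mem_support hA (Module.mem_support_iff_of_finite.mpr hann)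
  exact ((isAssociatedPrime_iff_exists_injective_linearMap _ _).mp hp).2

lemma subsingleton_torGrp_residueField (S : Type) [AddCommGroup S] [Module R S]
    (A : Type) [AddCommGroup A] [Module R A] [Module.Finite R A] [Nontrivial A]
    (hA : Module.support R A ⊆ {closedPoint R}) (htor : ∀ n, Subsingleton (TorGrp R (n + 1) S A))
    (j : ℕ) (hj : Subsingleton (TorGrp R (j + 1) S (R ⧸ maximalIdeal R))) (n : ℕ) :
    Subsingleton (TorGrp R (n + 1) S (R ⧸ maximalIdeal R)) := by
  have up (n : ℕ) (h : Subsingleton (TorGrp R (n + 1) S (R ⧸ maximalIdeal R))) :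
      Subsingleton (TorGrp R (n + 2) S (R ⧸ maximalIdeal R)) := by
    obtain ⟨f, hf⟩ := exists_surjective_to_residueField (R := R) A
    refine subsingleton_torGrp_quotient (Submodule.subtype_injective _)
      (LinearMap.exact_subtype_ker_map f) hf n S ?_ (htor (n + 1))
    exact subsingleton_torGrp_of_support_subset S n h _
      ((Module.support_subset_of_injective _ (Submodule.subtype_injective _)).trans hA)
  have down (n : ℕ) (h : Subsingleton (TorGrp R (n + 2) S (R ⧸ maximalIdeal R))) :
      Subsingleton (TorGrp R (n + 1) S (R ⧸ maximalIdeal R)) := by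
    obtain ⟨f, hf⟩ := exists_injective_from_residueField A hA
    refine subsingleton_torGrp_sub hf (LinearMap.exact_map_mkQ_range f)
      (Submodule.mkQ_surjective _) n S (htor n) ?_
    exact subsingleton_torGrp_of_support_subset S (n + 1) h _
      ((Module.support_subset_of_surjective _ (Submodule.mkQ_surjective _)).trans hA)
  rcases le_total j n with hjn | hnj
  · induction n, hjn using Nat.le_induction with
    | base => exact hj
    | succ n _ ih => exact up n ih
  · exact Nat.decreasingInduction (fun k _ hk => down k hk) hj hnj

end Rigidity

end TorRigidity

/-- If `(R, 𝔪)` is a Noetherian local Cohen-Macaulay ring with residue field `k` and `S`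
is a big Cohen-Macaulay `R`-algebra with `Tor_j^R(S, k) = 0` for some `j ≥ 1`, then
`Tor_n^R(S, k) = 0` for all `n ≥ 1`. -/
theorem tor_vanishing_rigidity_of_bigCM
    (R : Type) [CommRing R] [IsNoetherianRing R] [IsLocalRing R]
    (hCM : IsCohenMacaulayLocalRing R)
    (S : Type) [CommRing S] [Algebra R S]
    (hS : IsBigCohenMacaulayAlgebra R S)
    (j : ℕ) (hj : 1 ≤ j)
    (htor : Subsingleton (TorGrp R j S (IsLocalRing.ResidueField R))) :
    ∀ n : ℕ, 1 ≤ n → Subsingleton (TorGrp R n S (IsLocalRing.ResidueField R)) := by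
  obtain ⟨rs, hrs, hreg⟩ := hS
  have hrsR := TorRigidity.isWeaklyRegular_of_isSystemOfParameters hrs hCM
  obtain ⟨A, _, _, _, _, hann, htorA⟩ := TorRigidity.exists_torIndependent_of_isWeaklyRegular S rs
    hrs.1 R hrsR (((TensorProduct.rid R S).isWeaklyRegular_congr rs).mpr hreg.toIsWeaklyRegular)
    fun n => TorRigidity.subsingleton_torGrp_of_projective n S R
  have hA : Module.support R A ⊆ {IsLocalRing.closedPoint R} := by
    intro p hp
    refine PrimeSpectrum.ext ((IsLocalRing.maximalIdeal.isMaximal R).eq_of_le p.2.ne_top ?_).symm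
    rw [← hrs.2.2]
    exact p.2.radical_le_iff.mpr
      (le_sup_left.trans (hann.trans (Module.mem_support_iff_of_finite.mp hp)))
  intro n hn
  obtain ⟨j, rfl⟩ := Nat.exists_eq_succ_of_ne_zero (Nat.one_le_iff_ne_zero.mp hj)
  obtain ⟨n, rfl⟩ := Nat.exists_eq_succ_of_ne_zero (Nat.one_le_iff_ne_zero.mp hn)
  exact TorRigidity.subsingleton_torGrp_residueField S A hA htorA j htor n
end

section
/- Let (R, 𝔪) be a Noetherian local ring with residue field k = R/𝔪 and let S be a big Cohen–Macaulay R-algebra. If Tor_1^R(S, k) = 0 or Tor_2^R(S, k) = 0, then R is Cohen–Macaulay. -/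
set_option synthInstance.maxHeartbeats 1000000
set_option maxHeartbeats 1000000
set_option linter.unusedVariables false

open CategoryTheory

namespace BigCM

open TensorProduct LinearMap Function

section TorVanishing

variable (R S : Type) [CommRing R] [AddCommGroup S] [Module R S]

/-- An elementary form of `Tor_1^R(S, N) = 0`: every short exact sequence ending in `N`
stays left exact after tensoring with `S`. -/
def TorOneVanishes (N : Type) [AddCommGroup N] [Module R N] : Prop :=
  ∀ (K P : Type) [AddCommGroup K] [Module R K] [AddCommGroup P] [Module R P]
    (f : K →ₗ[R] P) (g : P →ₗ[R] N), Injective f → Surjective g → Exact f g →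
    Injective (f.lTensor S)

/-- An elementary form of `Tor_2^R(S, N) = 0`, phrased through `TorOneVanishes`. -/
def TorTwoVanishes (N : Type) [AddCommGroup N] [Module R N] : Prop :=
  ∀ (A B : Type) [AddCommGroup A] [Module R A] [AddCommGroup B] [Module R B]
    (f : A →ₗ[R] B) (g : B →ₗ[R] N), Injective f → Surjective g → Exact f g →
    TorOneVanishes R S B → TorOneVanishes R S A

variable {R S}
variable {N N' N'' : Type} [AddCommGroup N] [Module R N] [AddCommGroup N'] [Module R N']
  [AddCommGroup N''] [Module R N'']

/-- The first term of a short exact sequence is the kernel of the second map. -/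
noncomputable def kerEquivOfExact {f : N' →ₗ[R] N} {g : N →ₗ[R] N''} (hf : Injective f)
    (h : Exact f g) : N' ≃ₗ[R] ker g :=
  (LinearEquiv.ofInjective f hf).trans (LinearEquiv.ofEq _ _ h.linearMap_ker_eq.symm)

lemma TorOneVanishes.congr (h : TorOneVanishes R S N) (e : N ≃ₗ[R] N') :
    TorOneVanishes R S N' := by
  intro K P _ _ _ _ f g hf hg hfg
  refine h K P f (e.symm.toLinearMap ∘ₗ g) hf (e.symm.surjective.comp hg) fun x ↦ ?_
  simpa using hfg x

lemma TorTwoVanishes.congr (h : TorTwoVanishes R S N) (e : N ≃ₗ[R] N') :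
    TorTwoVanishes R S N' := by
  intro K P _ _ _ _ f g hf hg hfg
  refine h K P f (e.symm.toLinearMap ∘ₗ g) hf (e.symm.surjective.comp hg) fun x ↦ ?_
  simpa using hfg x

lemma TorOneVanishes.of_exact {i : N' →ₗ[R] N} {p : N →ₗ[R] N''} (hi : Injective i)
    (hp : Surjective p) (hip : Exact i p) (h' : TorOneVanishes R S N')
    (h'' : TorOneVanishes R S N'') : TorOneVanishes R S N := by
  intro K P _ _ _ _ f g hf hg hfg
  replace h' := h'.congr (kerEquivOfExact hi hip)
  let L := ker (p ∘ₗ g)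
  have hfL (x) : f x ∈ L := by simp [L, hfg.apply_apply_eq_zero]
  have hgL (x : L) : (g ∘ₗ L.subtype) x ∈ ker p := x.2
  have h1 : Injective ((f.codRestrict L hfL).lTensor S) := by
    refine h' K L _ ((g ∘ₗ L.subtype).codRestrict (ker p) hgL)
      (fun x y hxy ↦ hf congr(($hxy : P))) ?_ ?_
    · rintro ⟨y, hy⟩
      obtain ⟨x, rfl⟩ := hg y
      exact ⟨⟨x, hy⟩, rfl⟩
    · rintro ⟨x, hx⟩
      simp only [Subtype.ext_iff, Set.mem_range, LinearMap.codRestrict_apply]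
      exact hfg x
  have h2 : Injective (L.subtype.lTensor S) :=
    h'' L P _ (p ∘ₗ g) L.injective_subtype (hp.comp hg) (LinearMap.exact_subtype_ker_map _)
  have : f.lTensor S = L.subtype.lTensor S ∘ₗ (f.codRestrict L hfL).lTensor S := by
    rw [← LinearMap.lTensor_comp, LinearMap.subtype_comp_codRestrict]
  rw [this]
  exact h2.comp h1

lemma TorTwoVanishes.of_exact {i : N' →ₗ[R] N} {p : N →ₗ[R] N''} (hi : Injective i)
    (hp : Surjective p) (hip : Exact i p) (h' : TorTwoVanishes R S N')
    (h'' : TorTwoVanishes R S N'') : TorTwoVanishes R S N := by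
  intro K P _ _ _ _ f g hf hg hfg hP
  replace h' := h'.congr (kerEquivOfExact hi hip)
  let L := ker (p ∘ₗ g)
  have hfL (x) : f x ∈ L := by simp [L, hfg.apply_apply_eq_zero]
  have hgL (x : L) : (g ∘ₗ L.subtype) x ∈ ker p := x.2
  have h2 : TorOneVanishes R S L :=
    h'' L P _ (p ∘ₗ g) L.injective_subtype (hp.comp hg) (LinearMap.exact_subtype_ker_map _) hP
  refine h' K L (f.codRestrict L hfL) ((g ∘ₗ L.subtype).codRestrict (ker p) hgL)
      (fun x y hxy ↦ hf congr(($hxy : P))) ?_ ?_ h2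
  · rintro ⟨y, hy⟩
    obtain ⟨x, rfl⟩ := hg y
    exact ⟨⟨x, hy⟩, rfl⟩
  · rintro ⟨x, hx⟩
    simp only [Subtype.ext_iff, Set.mem_range, LinearMap.codRestrict_apply]
    exact hfg x

lemma injective_lTensor_of_comp_eq_id {i : N' →ₗ[R] N} {r : N →ₗ[R] N'}
    (h : r ∘ₗ i = .id) : Injective (i.lTensor S) := by
  have : LeftInverse (r.lTensor S) (i.lTensor S) := fun x ↦ by
    rw [← LinearMap.comp_apply, ← LinearMap.lTensor_comp, h, LinearMap.lTensor_id,
      LinearMap.id_apply]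
  exact this.injective

lemma TorOneVanishes.of_retract (h : TorOneVanishes R S N) (i : N' →ₗ[R] N) (r : N →ₗ[R] N')
    (hri : r ∘ₗ i = .id) : TorOneVanishes R S N' := by
  intro K P _ _ _ _ f g hf hg hfg
  have hri' (x) : r (i x) = x := congr($hri x)
  have := h K (P × ker r) (.inl R _ _ ∘ₗ f) ((i ∘ₗ g).coprod (ker r).subtype)
    (LinearMap.inl_injective.comp hf) (fun n ↦ ?_) (fun ⟨x, y⟩ ↦ ⟨fun hxy ↦ ?_, ?_⟩)
  · rw [LinearMap.lTensor_comp, LinearMap.coe_comp] at this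
    exact this.of_comp
  · obtain ⟨p, hp⟩ := hg (r n)
    exact ⟨(p, ⟨n - i (r n), by simp [hri']⟩), by simp [hp]⟩
  · have hgx : g x = 0 := by
      have := congr(r $hxy)
      simpa [hri', LinearMap.mem_ker.1 y.2] using this
    obtain ⟨k, rfl⟩ := (hfg x).1 hgx
    refine ⟨k, ?_⟩
    simp [hgx] at hxy
    simp [hxy]
  · rintro ⟨k, hk⟩
    simp [Prod.ext_iff] at hk
    simp [← hk.1, ← hk.2, hfg.apply_apply_eq_zero]

section Pullback

variable {K P K' P' : Type} [AddCommGroup K] [Module R K] [AddCommGroup P] [Module R P]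
  [AddCommGroup K'] [Module R K'] [AddCommGroup P'] [Module R P']
  {f : K →ₗ[R] P} {g : P →ₗ[R] N} {f' : K' →ₗ[R] P'} {g' : P' →ₗ[R] N}

/-- Two short exact sequences with the same last term, the first with projective middle term,
are compared through the pullback of their middle terms. -/
lemma exists_pullback [Module.Projective R P] (hf : Injective f) (hg : Surjective g)
    (hfg : Exact f g) (hf' : Injective f') (hg' : Surjective g') (hfg' : Exact f' g') :
    ∃ (Q : Submodule R (P × P')) (a : K →ₗ[R] Q) (a' : K' →ₗ[R] Q) (r : Q →ₗ[R] K')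
      (p : Q →ₗ[R] P) (p' : Q →ₗ[R] P'), Injective a ∧ Surjective p' ∧ Exact a p' ∧
      r ∘ₗ a' = .id ∧ p ∘ₗ a = f ∧ p' ∘ₗ a' = f' ∧ p ∘ₗ a' = 0 := by
  let Q := ker (g.coprod (-g'))
  let a : K →ₗ[R] Q := (.inl R _ _ ∘ₗ f : K →ₗ[R] P × P').codRestrict Q fun x ↦ by
    simp [Q, hfg.apply_apply_eq_zero]
  let a' : K' →ₗ[R] Q := (.inr R _ _ ∘ₗ f' : K' →ₗ[R] P × P').codRestrict Q fun x ↦ by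
    simp [Q, hfg'.apply_apply_eq_zero]
  let p : Q →ₗ[R] P := .fst R _ _ ∘ₗ Q.subtype
  let p' : Q →ₗ[R] P' := .snd R _ _ ∘ₗ Q.subtype
  have ha : Injective a := fun x y hxy ↦ hf congr(($hxy : P × P').1)
  have ha' : Injective a' := fun x y hxy ↦ hf' congr(($hxy : P × P').2)
  have hp : Surjective p := fun x ↦ by
    obtain ⟨y, hy⟩ := hg' (g x)
    exact ⟨⟨(x, y), by simp [Q, hy]⟩, rfl⟩
  have hp' : Surjective p' := fun x ↦ by
    obtain ⟨y, hy⟩ := hg (g' x)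
    exact ⟨⟨(y, x), by simp [Q, hy]⟩, rfl⟩
  have hap : Exact a p' := by
    rintro ⟨⟨x, y⟩, hxy⟩
    have hxy : g x + -g' y = 0 := hxy
    constructor
    · intro hy
      replace hy : y = 0 := hy
      subst hy
      obtain ⟨k, rfl⟩ := (hfg x).1 (by simpa using hxy)
      exact ⟨k, rfl⟩
    · rintro ⟨k, hk⟩
      exact congr(($hk : P × P').2).symm
  have hap' : Exact a' p := by
    rintro ⟨⟨x, y⟩, hxy⟩
    have hxy : g x + -g' y = 0 := hxy
    constructor
    · intro hy
      replace hy : x = 0 := hy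
      subst hy
      obtain ⟨k, rfl⟩ := (hfg' y).1 (by simpa using hxy)
      exact ⟨k, rfl⟩
    · rintro ⟨k, hk⟩
      exact congr(($hk : P × P').1).symm
  obtain ⟨s, hs⟩ := Module.projective_lifting_property p .id hp
  have hsplit := hap'.split_tfae'.out 0 1
  obtain ⟨-, r, hr⟩ := hsplit.1 ⟨ha', s, hs⟩
  exact ⟨Q, a, a', r, p, p', ha, hp', hap, hr, rfl, rfl, rfl⟩

lemma TorOneVanishes.of_projective_presentation [Module.Projective R P] (hf : Injective f)
    (hg : Surjective g) (hfg : Exact f g) (h : Injective (f.lTensor S)) :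
    TorOneVanishes R S N := by
  intro K' P' _ _ _ _ f' g' hf' hg' hfg'
  obtain ⟨Q, a, a', r, p, p', ha, hp', hap, hr, rfl, rfl, hpa⟩ :=
    exists_pullback hf hg hfg hf' hg' hfg'
  rw [injective_iff_map_eq_zero]
  intro t ht
  rw [LinearMap.lTensor_comp, LinearMap.comp_apply] at ht
  obtain ⟨u, hu⟩ := (lTensor_exact S hap hp' _).1 ht
  have hu0 : u = 0 := by
    apply (injective_iff_map_eq_zero _).1 h
    rw [LinearMap.lTensor_comp, LinearMap.comp_apply, hu, ← LinearMap.comp_apply,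
      ← LinearMap.lTensor_comp, hpa, LinearMap.lTensor_zero, LinearMap.zero_apply]
  apply (injective_iff_map_eq_zero _).1 (injective_lTensor_of_comp_eq_id hr)
  rw [← hu, hu0, map_zero]

lemma TorTwoVanishes.of_projective_presentation [Module.Projective R P] (hf : Injective f)
    (hg : Surjective g) (hfg : Exact f g) (h : TorOneVanishes R S K) :
    TorTwoVanishes R S N := by
  intro K' P' _ _ _ _ f' g' hf' hg' hfg' hP'
  obtain ⟨Q, a, a', r, p, p', ha, hp', hap, hr, rfl, rfl, hpa⟩ :=
    exists_pullback hf hg hfg hf' hg' hfg'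
  exact (TorOneVanishes.of_exact ha hp' hap h hP').of_retract a' r hr

end Pullback

lemma TorOneVanishes.of_projective [Module.Projective R N] : TorOneVanishes R S N := by
  refine .of_projective_presentation (K := PUnit) (f := 0) (g := (.id : N →ₗ[R] N))
    (injective_of_subsingleton _) surjective_id (fun x ↦ ?_) (injective_of_subsingleton _)
  simp [eq_comm]

lemma TorTwoVanishes.of_subsingleton [Subsingleton N] : TorTwoVanishes R S N := by
  intro A B _ _ _ _ f g hf hg hfg hB
  have : Surjective f := fun b ↦ (hfg b).1 (Subsingleton.elim _ _)
  exact hB.congr (LinearEquiv.ofBijective f ⟨hf, this⟩).symm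

section Resolution

variable {P₂ P₁ P₀ : Type} [AddCommGroup P₂] [Module R P₂] [AddCommGroup P₁] [Module R P₁]
  [AddCommGroup P₀] [Module R P₀] {f : P₂ →ₗ[R] P₁} {g : P₁ →ₗ[R] P₀}

lemma injective_lTensor_range_subtype (hfg : Exact f g)
    (h : Exact (f.lTensor S) (g.lTensor S)) : Injective ((range g).subtype.lTensor S) := by
  rw [injective_iff_map_eq_zero]
  intro t ht
  obtain ⟨u, rfl⟩ := LinearMap.lTensor_surjective S g.surjective_rangeRestrict t
  rw [← LinearMap.comp_apply, ← LinearMap.lTensor_comp, LinearMap.subtype_comp_codRestrict] at ht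
  obtain ⟨v, rfl⟩ := (h u).1 ht
  have : g.rangeRestrict ∘ₗ f = 0 := by
    ext x
    exact hfg.apply_apply_eq_zero x
  rw [← LinearMap.comp_apply, ← LinearMap.lTensor_comp, this, LinearMap.lTensor_zero,
    LinearMap.zero_apply]

end Resolution

end TorVanishing

section Tor

variable {R : Type} [CommRing R] {S N : Type} [AddCommGroup S] [Module R S]
  [AddCommGroup N] [Module R N]

lemma exact_lTensor_of_subsingleton_tor (P : ProjectiveResolution (ModuleCat.of R N)) (n : ℕ)
    (h : Subsingleton (TorGrp R (n + 1) S N)) :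
    Exact ((P.complex.d (n + 2) (n + 1)).hom.lTensor S)
      ((P.complex.d (n + 1) n).hom.lTensor S) := by
  let F := (MonoidalCategory.tensoringLeft (ModuleCat R)).obj (ModuleCat.of R S)
  have h0 : Limits.IsZero (((F.mapHomologicalComplex (ComplexShape.down ℕ)).obj
      P.complex).homology (n + 1)) :=
    (ModuleCat.isZero_of_subsingleton (((Tor (ModuleCat R) (n + 1)).obj
      (ModuleCat.of R S)).obj (ModuleCat.of R N))).of_iso (P.isoLeftDerivedObj F (n + 1)).symm
  rw [← HomologicalComplex.exactAt_iff_isZero_homology,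
    HomologicalComplex.exactAt_iff' _ (n + 2) (n + 1) n (by simp) (by simp),
    ShortComplex.ShortExact.moduleCat_exact_iff_function_exact] at h0
  exact h0

lemma exact_d_d (P : ProjectiveResolution (ModuleCat.of R N)) (n : ℕ) :
    Exact (P.complex.d (n + 2) (n + 1)).hom (P.complex.d (n + 1) n).hom :=
  (ShortComplex.ShortExact.moduleCat_exact_iff_function_exact _).1 (P.exact_succ n)

lemma exact_d_π (P : ProjectiveResolution (ModuleCat.of R N)) :
    Exact (P.complex.d 1 0).hom (P.π.f 0).hom :=
  (ShortComplex.ShortExact.moduleCat_exact_iff_function_exact _).1 P.exact₀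

instance (P : ProjectiveResolution (ModuleCat.of R N)) (n : ℕ) :
    Module.Projective R (P.complex.X n) :=
  (IsProjective.iff_projective _).2 (P.projective n)

lemma exact_range_subtype {A B C : Type} [AddCommGroup A] [Module R A] [AddCommGroup B]
    [Module R B] [AddCommGroup C] [Module R C] {f : A →ₗ[R] B} {g : B →ₗ[R] C}
    (h : Exact f g) : Exact (range f).subtype g := by
  intro x
  simpa using h x

lemma torOneVanishes_of_subsingleton_tor (h : Subsingleton (TorGrp R 1 S N)) :
    TorOneVanishes R S N := by
  let P := projectiveResolution (ModuleCat.of R N)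
  exact .of_projective_presentation (f := (range (P.complex.d 1 0).hom).subtype)
    (g := (P.π.f 0).hom) (Submodule.injective_subtype _)
    ((ModuleCat.epi_iff_surjective _).1 inferInstance) (exact_range_subtype (exact_d_π P))
    (injective_lTensor_range_subtype (exact_d_d P 0) (exact_lTensor_of_subsingleton_tor P 0 h))

lemma torTwoVanishes_of_subsingleton_tor (h : Subsingleton (TorGrp R 2 S N)) :
    TorTwoVanishes R S N := by
  let P := projectiveResolution (ModuleCat.of R N)
  have h1 : TorOneVanishes R S (range (P.complex.d 1 0).hom) := by
    refine .of_projective_presentation (f := (range (P.complex.d 2 1).hom).subtype)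
      (g := (P.complex.d 1 0).hom.rangeRestrict) (Submodule.injective_subtype _)
      (surjective_rangeRestrict _) (fun x ↦ ?_)
      (injective_lTensor_range_subtype (exact_d_d P 1) (exact_lTensor_of_subsingleton_tor P 1 h))
    rw [← exact_range_subtype (exact_d_d P 0) x, Subtype.ext_iff]
    rfl
  exact .of_projective_presentation (f := (range (P.complex.d 1 0).hom).subtype)
    (g := (P.π.f 0).hom) (Submodule.injective_subtype _)
    ((ModuleCat.epi_iff_surjective _).1 inferInstance) (exact_range_subtype (exact_d_π P)) h1

end Tor

section FiniteLength

variable {R S : Type} [CommRing R] [IsNoetherianRing R] [IsLocalRing R]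

open IsLocalRing

/-- A predicate on finite modules over a Noetherian local ring that holds for zero modules and for
the residue field, and is stable under extensions, holds for all finite modules annihilated by a
power of the maximal ideal. -/
lemma induction_of_annihilated_by_pow
    {motive : (N : Type) → [AddCommGroup N] → [Module R N] → Prop}
    (subsingleton : ∀ (N : Type) [AddCommGroup N] [Module R N] [Subsingleton N], motive N)
    (residue : ∀ (N : Type) [AddCommGroup N] [Module R N] (_ : ResidueField R ≃ₗ[R] N), motive N)
    (exact : ∀ (N₁ N₂ N₃ : Type) [AddCommGroup N₁] [Module R N₁] [AddCommGroup N₂] [Module R N₂]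
      [AddCommGroup N₃] [Module R N₃] (f : N₁ →ₗ[R] N₂) (g : N₂ →ₗ[R] N₃),
      Injective f → Surjective g → Exact f g → motive N₁ → motive N₃ → motive N₂)
    (N : Type) [AddCommGroup N] [Module R N] [hN : Module.Finite R N]
    (n : ℕ) (h : ∀ r ∈ maximalIdeal R ^ n, ∀ x : N, r • x = 0) : motive N := by
  induction hN using IsNoetherianRing.induction_on_isQuotientEquivQuotientPrime R with
  | subsingleton N => exact subsingleton N
  | quotient N p e =>
    have hp : maximalIdeal R ^ n ≤ p.1 := fun r hr ↦ by
      have h1 := congr(e $(h r hr (e.symm (Ideal.Quotient.mk _ 1))))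
      simpa [Algebra.smul_def, Ideal.Quotient.eq_zero_iff_mem] using h1
    have hpm : p.1 = maximalIdeal R :=
      le_antisymm (le_maximalIdeal p.2.ne_top) (p.2.le_of_pow_le hp)
    exact residue N ((Submodule.quotEquivOfEq _ _ hpm.symm).trans e.symm)
  | exact N₁ N₂ N₃ f g hf hg hfg h₁ h₃ =>
    refine exact N₁ N₂ N₃ f g hf hg hfg (h₁ fun r hr x ↦ hf ?_) (h₃ fun r hr x ↦ ?_)
    · rw [map_smul, h r hr, map_zero]
    · obtain ⟨x, rfl⟩ := hg x
      rw [← map_smul, h r hr, map_zero]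

variable [CommRing S] [Algebra R S]

lemma TorOneVanishes.of_annihilated_by_pow (hk : TorOneVanishes R S (ResidueField R))
    (N : Type) [AddCommGroup N] [Module R N] [Module.Finite R N]
    (n : ℕ) (h : ∀ r ∈ maximalIdeal R ^ n, ∀ x : N, r • x = 0) : TorOneVanishes R S N :=
  induction_of_annihilated_by_pow (motive := fun N ↦ TorOneVanishes R S N)
    (fun _ ↦ .of_projective) (fun _ _ _ e ↦ hk.congr e)
    (fun _ _ _ _ _ _ _ _ _ _ _ hf hg hfg ↦ .of_exact hf hg hfg) N n h

lemma TorTwoVanishes.of_annihilated_by_pow (hk : TorTwoVanishes R S (ResidueField R))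
    (N : Type) [AddCommGroup N] [Module R N] [Module.Finite R N]
    (n : ℕ) (h : ∀ r ∈ maximalIdeal R ^ n, ∀ x : N, r • x = 0) : TorTwoVanishes R S N :=
  induction_of_annihilated_by_pow (motive := fun N ↦ TorTwoVanishes R S N)
    (fun _ ↦ .of_subsingleton) (fun _ _ _ e ↦ hk.congr e)
    (fun _ _ _ _ _ _ _ _ _ _ _ hf hg hfg ↦ .of_exact hf hg hfg) N n h

lemma subsingleton_of_subsingleton_tensor [Nontrivial (S ⊗[R] ResidueField R)]
    (N : Type) [AddCommGroup N] [Module R N] [Module.Finite R N]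
    (h : Subsingleton (S ⊗[R] N)) : Subsingleton N := by
  by_contra hN
  rw [not_subsingleton_iff_nontrivial] at hN
  obtain ⟨W, hW, -⟩ := (eq_top_or_exists_le_coatom (⊥ : Submodule R N)).resolve_left bot_ne_top
  obtain ⟨I, hI, ⟨e⟩⟩ := isSimpleModule_iff_quot_maximal.1 (isSimpleModule_iff_isCoatom.2 hW)
  obtain rfl := eq_maximalIdeal hI
  have hsurj := LinearMap.lTensor_surjective S
    (g := (e.toLinearMap ∘ₗ W.mkQ : N →ₗ[R] ResidueField R)) (e.surjective.comp W.mkQ_surjective)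
  exact not_subsingleton (S ⊗[R] ResidueField R) hsurj.subsingleton

/-- If `Tor_1^R(S, k) = 0` and `S ⊗ k ≠ 0`, then finite modules annihilated by a power of the
maximal ideal embed into their base change to `S`. -/
lemma eq_zero_of_one_tmul_eq_zero [Nontrivial (S ⊗[R] ResidueField R)]
    (hk : TorOneVanishes R S (ResidueField R))
    (N : Type) [AddCommGroup N] [Module R N] [Module.Finite R N]
    (n : ℕ) (h : ∀ r ∈ maximalIdeal R ^ n, ∀ x : N, r • x = 0)
    (x : N) (hx : (1 : S) ⊗ₜ[R] x = 0) : x = 0 := by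
  let W := R ∙ x
  have hW : Injective (W.subtype.lTensor S) := by
    refine TorOneVanishes.of_annihilated_by_pow hk (N ⧸ W) n (fun r hr y ↦ ?_) W N _ W.mkQ
      W.injective_subtype W.mkQ_surjective (LinearMap.exact_subtype_mkQ W)
    obtain ⟨y, rfl⟩ := W.mkQ_surjective y
    rw [← map_smul, h r hr, map_zero]
  have hxW : x ∈ W := Submodule.mem_span_singleton_self x
  have h1 : (1 : S) ⊗ₜ[R] (⟨x, hxW⟩ : W) = 0 := hW (by simpa using hx)
  have h2 : ∀ t : S ⊗[R] W, t = 0 := fun t ↦ by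
    induction t with
    | zero => rfl
    | add a b ha hb => rw [ha, hb, add_zero]
    | tmul s y =>
      obtain ⟨y, hy⟩ := y
      obtain ⟨c, rfl⟩ := Submodule.mem_span_singleton.1 hy
      have : s ⊗ₜ[R] (⟨c • x, hy⟩ : W) = (c • s) • ((1 : S) ⊗ₜ[R] (⟨x, hxW⟩ : W)) := by
        rw [TensorProduct.smul_tmul', smul_eq_mul, mul_one, TensorProduct.smul_tmul]
        rfl
      rw [this, h1, smul_zero]
  have := subsingleton_of_subsingleton_tensor (S := S) W ⟨fun a b ↦ by rw [h2 a, h2 b]⟩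
  exact congr(($(Subsingleton.elim (⟨x, hxW⟩ : W) 0) : N))

end FiniteLength

section Koszul

variable {R : Type} [CommRing R] {m : ℕ}

/-- The submodule of `M ^ m` spanned by the Koszul relations among the first `k` of the elements
`z i`. -/
def koszulRelations (z : Fin m → R) (M : Type) [AddCommGroup M] [Module R M] (k : ℕ) :
    Submodule R (Fin m → M) :=
  Submodule.span R {v | ∃ (i j : Fin m) (c : M), i.val < k ∧ j.val < k ∧
    v = Pi.single j (z i • c) - Pi.single i (z j • c)}

/-- The elements `z i` form a weakly regular sequence on `M`, expressed through coefficients. -/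
def IsRegularFamily (z : Fin m → R) (M : Type) [AddCommGroup M] [Module R M] : Prop :=
  ∀ (k : Fin m) (x : M) (c : Fin m → M), (∀ l, k ≤ l → c l = 0) → z k • x = ∑ l, z l • c l →
    ∃ c' : Fin m → M, (∀ l, k ≤ l → c' l = 0) ∧ x = ∑ l, z l • c' l

variable {z : Fin m → R} {M : Type} [AddCommGroup M] [Module R M]

lemma koszulRelations_mono {k l : ℕ} (h : k ≤ l) :
    koszulRelations z M k ≤ koszulRelations z M l :=
  Submodule.span_mono fun _ ⟨i, j, c, hi, hj, hv⟩ ↦ ⟨i, j, c, hi.trans_le h, hj.trans_le h, hv⟩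

lemma sum_smul_single (l : Fin m) (c : M) :
    ∑ i, z i • (Pi.single l c : Fin m → M) i = z l • c := by
  rw [Finset.sum_eq_single l] <;> simp +contextual

lemma sum_smul_eq_zero_of_mem_koszulRelations {k : ℕ} {v : Fin m → M}
    (hv : v ∈ koszulRelations z M k) : ∑ i, z i • v i = 0 := by
  induction hv using Submodule.span_induction with
  | mem v hv =>
    obtain ⟨i, j, c, -, -, rfl⟩ := hv
    simp only [Pi.sub_apply, smul_sub, Finset.sum_sub_distrib, sum_smul_single]
    rw [smul_comm, sub_self]
  | zero => simp
  | add x y _ _ hx hy => simp [smul_add, Finset.sum_add_distrib, hx, hy]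
  | smul r x _ hx => simp_rw [Pi.smul_apply, smul_comm _ r, ← Finset.smul_sum, hx, smul_zero]

/-- Relations of a regular family are generated by the Koszul relations. -/
lemma IsRegularFamily.mem_koszulRelations (hz : IsRegularFamily z M) (v : Fin m → M)
    (hv : ∑ i, z i • v i = 0) : v ∈ koszulRelations z M m := by
  suffices H : ∀ k ≤ m, ∀ v : Fin m → M, (∀ l, k ≤ l.val → v l = 0) → ∑ i, z i • v i = 0 →
      v ∈ koszulRelations z M k from
    H m le_rfl v (fun l hl ↦ absurd l.2 hl.not_gt) hv
  intro k
  induction k with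
  | zero =>
    intro _ v hv _
    rw [show v = 0 from funext fun l ↦ hv l (Nat.zero_le _)]
    exact zero_mem _
  | succ k ih =>
    intro hk v hv hsum
    let κ : Fin m := ⟨k, hk⟩
    obtain ⟨c, hc, hvc⟩ := hz κ (v κ) (Pi.single κ (v κ) - v) (fun l hl ↦ by
        rcases hl.eq_or_lt with rfl | hl
        · simp
        · simp [hl.ne', hv l hl]) (by
        simp only [Pi.sub_apply, smul_sub, Finset.sum_sub_distrib, sum_smul_single, hsum, sub_zero])
    let w : Fin m → M := ∑ l, (Pi.single κ (z l • c l) - Pi.single l (z κ • c l))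
    have hw : w ∈ koszulRelations z M (k + 1) := by
      refine Submodule.sum_mem _ fun l _ ↦ ?_
      by_cases hl : κ ≤ l
      · simp [hc l hl]
      · have hl' : l.val < k := not_le.1 hl
        exact Submodule.subset_span ⟨l, κ, c l, hl'.trans (Nat.lt_succ_self k),
          Nat.lt_succ_self k, rfl⟩
    have hw' : w = Pi.single κ (v κ) - z κ • c := by
      simp only [w, Finset.sum_sub_distrib]
      congr 1
      · rw [hvc]
        exact (map_sum (LinearMap.single R (fun _ : Fin m ↦ M) κ) _ _).symm
      · ext i
        simp [Finset.sum_apply, Pi.single_apply]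
    have h1 : v - w ∈ koszulRelations z M k := by
      refine ih (by omega) _ (fun l hl ↦ ?_) ?_
      · rw [hw']
        rcases (show κ ≤ l from hl).eq_or_lt with rfl | hl'
        · simp [hc κ le_rfl]
        · simp [hl'.ne', hv l hl', hc l hl'.le]
      · simp only [Pi.sub_apply, smul_sub, Finset.sum_sub_distrib, hsum,
          sum_smul_eq_zero_of_mem_koszulRelations hw, sub_self]
    simpa using add_mem (koszulRelations_mono (Nat.le_succ k) h1) hw

lemma exists_of_mem_koszulRelations_succ (κ : Fin m) (v : Fin m → M)
    (hv : v ∈ koszulRelations z M (κ + 1)) :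
    ∃ c : Fin m → M, (∀ l, κ ≤ l → c l = 0) ∧ ∃ w ∈ koszulRelations z M κ,
      v = w + (Pi.single κ (∑ l, z l • c l) - z κ • c) := by
  induction hv using Submodule.span_induction with
  | mem v hv =>
    obtain ⟨i, j, c, hi, hj, rfl⟩ := hv
    rcases (Nat.lt_succ_iff_lt_or_eq.1 hi) with hi' | hi' <;>
      rcases (Nat.lt_succ_iff_lt_or_eq.1 hj) with hj' | hj'
    · exact ⟨0, by simp, _, Submodule.subset_span ⟨i, j, c, hi', hj', rfl⟩, by simp⟩
    · obtain rfl := Fin.ext hj'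
      refine ⟨Pi.single i c, fun l hl ↦ ?_, 0, zero_mem _, ?_⟩
      · rw [Pi.single_eq_of_ne]
        rintro rfl
        exact hi'.not_ge hl
      · rw [sum_smul_single, zero_add, ← Pi.single_smul]
    · obtain rfl := Fin.ext hi'
      refine ⟨-Pi.single j c, fun l hl ↦ ?_, 0, zero_mem _, ?_⟩
      · rw [Pi.neg_apply, Pi.single_eq_of_ne, neg_zero]
        rintro rfl
        exact hj'.not_ge hl
      · simp only [Pi.neg_apply, smul_neg, Finset.sum_neg_distrib, sum_smul_single, Pi.single_neg,
          ← Pi.single_smul]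
        abel
    · obtain rfl := Fin.ext (hi'.trans hj'.symm)
      exact ⟨0, by simp, 0, zero_mem _, by simp⟩
  | zero => exact ⟨0, by simp, 0, zero_mem _, by simp⟩
  | add x y _ _ hx hy =>
    obtain ⟨c, hc, w, hw, rfl⟩ := hx
    obtain ⟨c', hc', w', hw', rfl⟩ := hy
    refine ⟨c + c', fun l hl ↦ by simp [hc l hl, hc' l hl], _, add_mem hw hw', ?_⟩
    simp only [Pi.add_apply, smul_add, Finset.sum_add_distrib, Pi.single_add]
    abel
  | smul r x _ hx =>
    obtain ⟨c, hc, w, hw, rfl⟩ := hx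
    refine ⟨r • c, fun l hl ↦ by simp [hc l hl], _, Submodule.smul_mem _ r hw, ?_⟩
    simp_rw [Pi.smul_apply, smul_comm _ r, ← Finset.smul_sum, Pi.single_smul, smul_add, smul_sub]

lemma apply_eq_zero_of_mem_koszulRelations {k : ℕ} {v : Fin m → M}
    (hv : v ∈ koszulRelations z M k) {l : Fin m} (hl : k ≤ l.val) : v l = 0 := by
  induction hv using Submodule.span_induction with
  | mem v hv =>
    obtain ⟨i, j, c, hi, hj, rfl⟩ := hv
    rw [Pi.sub_apply, Pi.single_eq_of_ne, Pi.single_eq_of_ne, sub_zero] <;> rintro rfl <;> omega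
  | zero => rfl
  | add x y _ _ hx hy => simp [hx, hy]
  | smul r x _ hx => simp [hx]

/-- Over a Noetherian local ring, a family in the maximal ideal all of whose relations are Koszul
relations is regular. -/
lemma isRegularFamily_of_forall_mem_koszulRelations [IsNoetherianRing R] [IsLocalRing R]
    [Module.Finite R M] (hzm : ∀ i, z i ∈ IsLocalRing.maximalIdeal R)
    (h : ∀ v : Fin m → M, ∑ i, z i • v i = 0 → v ∈ koszulRelations z M m) :
    IsRegularFamily z M := by
  have key : ∀ n k, n + k = m → ∀ v : Fin m → M, (∀ l, k ≤ l.val → v l = 0) →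
      ∑ i, z i • v i = 0 → v ∈ koszulRelations z M k := by
    intro n
    induction n with
    | zero =>
      intro k hk v _ hv
      obtain rfl : k = m := by omega
      exact h v hv
    | succ n ih =>
      intro k hk
      let κ : Fin m := ⟨k, by omega⟩
      let W : Submodule R (Fin m → M) :=
        { carrier := {v | (∀ l, κ ≤ l → v l = 0) ∧ ∑ i, z i • v i = 0}
          add_mem' := fun {a b} ha hb ↦ ⟨fun l hl ↦ by simp [ha.1 l hl, hb.1 l hl],
            by simp [smul_add, Finset.sum_add_distrib, ha.2, hb.2]⟩
          zero_mem' := by simp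
          smul_mem' := fun r v hv ↦ ⟨fun l hl ↦ by simp [hv.1 l hl], by
            simp_rw [Pi.smul_apply, smul_comm _ r, ← Finset.smul_sum, hv.2, smul_zero]⟩ }
      suffices W ≤ koszulRelations z M k from fun v hv hv' ↦ this ⟨hv, hv'⟩
      refine Submodule.le_of_le_smul_of_le_jacobson_bot (IsNoetherian.noetherian W)
        (IsLocalRing.maximalIdeal_le_jacobson ⊥) fun v hv ↦ ?_
      obtain ⟨c, hc, w, hw, rfl⟩ := exists_of_mem_koszulRelations_succ κ v
        (ih (k + 1) (by omega) v (fun l hl ↦ hv.1 l ((Nat.le_succ k).trans hl)) hv.2)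
      have h0 : ∑ l, z l • c l = 0 := by
        simpa [apply_eq_zero_of_mem_koszulRelations hw le_rfl, hc κ le_rfl] using hv.1 κ le_rfl
      rw [h0, Pi.single_zero, zero_sub, ← smul_neg]
      exact add_mem (Submodule.mem_sup_left hw) (Submodule.mem_sup_right
        (Submodule.smul_mem_smul (hzm κ) (neg_mem ⟨hc, h0⟩)))
  intro κ x c hc hx
  obtain ⟨c', hc', w, hw, hv⟩ := exists_of_mem_koszulRelations_succ κ (Pi.single κ x - c)
    (key (m - (κ + 1)) (κ + 1) (by omega) _ (fun l hl ↦ by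
      have hl' : κ < l := hl
      simp [hl'.ne', hc l hl'.le]) (by
      simp only [Pi.sub_apply, smul_sub, Finset.sum_sub_distrib, sum_smul_single, hx, sub_self]))
  have h1 := congr_fun hv κ
  simp only [Pi.sub_apply, Pi.add_apply, Pi.smul_apply, Pi.single_eq_same, hc κ le_rfl,
    hc' κ le_rfl, apply_eq_zero_of_mem_koszulRelations hw le_rfl, smul_zero, sub_zero,
    zero_add] at h1
  exact ⟨c', hc', h1⟩

end Koszul

section RegularSequence

variable {R : Type} [CommRing R] {M : Type} [AddCommGroup M] [Module R M]

lemma mem_ofList_take_smul_top_iff (rs : List R) (k : ℕ) (x : M) :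
    x ∈ (Ideal.ofList (rs.take k) • ⊤ : Submodule R M) ↔
      ∃ c : Fin rs.length → M, (∀ l, k ≤ l.val → c l = 0) ∧ x = ∑ l, rs[l] • c l := by
  constructor
  · intro hx
    induction hx using Submodule.smul_induction_on' with
    | smul r hr y _ =>
      induction hr using Submodule.span_induction with
      | mem r hr =>
        obtain ⟨i, hi, rfl⟩ := List.mem_iff_getElem.1 hr
        simp only [List.length_take, lt_min_iff] at hi
        refine ⟨Pi.single ⟨i, hi.2⟩ y, fun l hl ↦ ?_, ?_⟩
        · rw [Pi.single_eq_of_ne]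
          rintro rfl
          exact hi.1.not_ge hl
        · rw [sum_smul_single (z := fun l : Fin rs.length ↦ rs[l])]
          simp
      | zero => exact ⟨0, by simp, by simp⟩
      | add a b _ _ ha hb =>
        obtain ⟨c, hc, h⟩ := ha
        obtain ⟨c', hc', h'⟩ := hb
        exact ⟨c + c', fun l hl ↦ by simp [hc l hl, hc' l hl],
          by simp [add_smul, h, h', smul_add, Finset.sum_add_distrib]⟩
      | smul a b _ hb =>
        obtain ⟨c, hc, h⟩ := hb
        refine ⟨a • c, fun l hl ↦ by simp [hc l hl], ?_⟩
        simp_rw [Pi.smul_apply, smul_comm _ a, ← Finset.smul_sum, ← h, smul_assoc]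
    | add a _ b _ ha hb =>
      obtain ⟨c, hc, h⟩ := ha
      obtain ⟨c', hc', h'⟩ := hb
      exact ⟨c + c', fun l hl ↦ by simp [hc l hl, hc' l hl],
        by simp [h, h', smul_add, Finset.sum_add_distrib]⟩
  · rintro ⟨c, hc, rfl⟩
    refine Submodule.sum_mem _ fun l _ ↦ ?_
    by_cases hl : k ≤ l.val
    · simp [hc l hl]
    · refine Submodule.smul_mem_smul (Ideal.subset_span ?_) Submodule.mem_top
      exact List.mem_take_iff_getElem.2 ⟨l, by simp; omega, rfl⟩

lemma isWeaklyRegular_iff_isRegularFamily (rs : List R) :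
    RingTheory.Sequence.IsWeaklyRegular M rs ↔
      IsRegularFamily (fun l : Fin rs.length ↦ rs[l]) M := by
  rw [RingTheory.Sequence.isWeaklyRegular_iff_Fin]
  refine forall_congr' fun k ↦ ?_
  rw [isSMulRegular_quotient_iff_mem_of_smul_mem]
  refine forall_congr' fun x ↦ ?_
  simp only [mem_ofList_take_smul_top_iff, forall_exists_index, and_imp]
  rfl

end RegularSequence

section BaseChange

variable {R S : Type} [CommRing R] [CommRing S] [Algebra R S] {m : ℕ} {z : Fin m → R}

lemma exists_piScalarRightHom_lTensor_eq {v : Fin m → S} (hv : v ∈ koszulRelations z S m) :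
    ∃ u : S ⊗[R] koszulRelations z R m,
      piScalarRightHom R R S (Fin m) ((koszulRelations z R m).subtype.lTensor S u) = v := by
  induction hv using Submodule.span_induction with
  | mem v hv =>
    obtain ⟨i, j, c, hi, hj, rfl⟩ := hv
    refine ⟨c ⊗ₜ ⟨_, Submodule.subset_span ⟨i, j, 1, hi, hj, rfl⟩⟩, ?_⟩
    ext l
    simp [Pi.single_apply, sub_smul, ite_smul]
  | zero => exact ⟨0, by simp⟩
  | add x y _ _ hx hy =>
    obtain ⟨u, rfl⟩ := hx
    obtain ⟨u', rfl⟩ := hy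
    exact ⟨u + u', by simp only [map_add]⟩
  | smul r x _ hx =>
    obtain ⟨u, rfl⟩ := hx
    exact ⟨r • u, by simp only [map_smul]⟩

/-- The module of relations between the `z i`. -/
def relations (z : Fin m → R) : Submodule R (Fin m → R) := ker (Fintype.linearCombination R z)

lemma mem_relations_iff {a : Fin m → R} : a ∈ relations z ↔ ∑ i, z i • a i = 0 := by
  simp [relations, Fintype.linearCombination_apply, mul_comm]

lemma koszulRelations_le_relations : koszulRelations z R m ≤ relations z :=
  fun _ ha ↦ mem_relations_iff.2 (sum_smul_eq_zero_of_mem_koszulRelations ha)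

/-- If the `z i` form a regular family on `S`, then all the relations coming from `R` become Koszul
relations over `S`. -/
lemma IsRegularFamily.exists_lTensor_inclusion_eq (hz : IsRegularFamily z S)
    (t : S ⊗[R] relations z) : ∃ u : S ⊗[R] koszulRelations z R m,
      (relations z).subtype.lTensor S
        ((Submodule.inclusion koszulRelations_le_relations).lTensor S u) =
      (relations z).subtype.lTensor S t := by
  have h1 : ∑ i, z i • piScalarRightHom R R S (Fin m)
      ((relations z).subtype.lTensor S t) i = 0 := by
    induction t with
    | zero => simp
    | add x y hx hy => simp only [map_add, Pi.add_apply, smul_add, Finset.sum_add_distrib, hx, hy,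
        add_zero]
    | tmul s a =>
      simp only [lTensor_tmul, Submodule.subtype_apply, piScalarRightHom_tmul, ← smul_assoc,
        ← Finset.sum_smul, mem_relations_iff.1 a.2, zero_smul]
  obtain ⟨u, hu⟩ := exists_piScalarRightHom_lTensor_eq (hz.mem_koszulRelations _ h1)
  refine ⟨u, (piScalarRight R R S (Fin m)).injective ?_⟩
  rw [← LinearMap.comp_apply, ← LinearMap.lTensor_comp, Submodule.subtype_comp_inclusion]
  exact hu

end BaseChange

section Conclusion

open IsLocalRing

variable {R S : Type} [CommRing R] [IsNoetherianRing R] [IsLocalRing R] [CommRing S] [Algebra R S]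
  {m : ℕ} {z : Fin m → R}

lemma relations_le_koszulRelations_of_torTwoVanishes [Nontrivial (S ⊗[R] ResidueField R)]
    (hz : IsRegularFamily z S) (n : ℕ) (hn : maximalIdeal R ^ n ≤ Ideal.span (Set.range z))
    (h : TorTwoVanishes R S (ResidueField R)) : relations z ≤ koszulRelations z R m := by
  let g := Fintype.linearCombination R z
  have hI : range g = Ideal.span (Set.range z) := Fintype.range_linearCombination R z
  have h2 : TorTwoVanishes R S (R ⧸ range g) := by
    refine h.of_annihilated_by_pow _ n fun r hr x ↦ ?_
    obtain ⟨x, rfl⟩ := (range g).mkQ_surjective x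
    rw [← map_smul, Submodule.mkQ_apply, Submodule.Quotient.mk_eq_zero, hI, smul_eq_mul]
    exact Ideal.mul_mem_right _ _ (hn hr)
  have h1 : TorOneVanishes R S (range g) :=
    h2 _ _ (range g).subtype (range g).mkQ (Submodule.injective_subtype _)
      (Submodule.mkQ_surjective _) (exact_subtype_mkQ _) .of_projective
  have hinj : Injective ((relations z).subtype.lTensor S) :=
    h1 _ _ (relations z).subtype g.rangeRestrict (Submodule.injective_subtype _)
      g.surjective_rangeRestrict fun x ↦ by
        rw [Submodule.coe_subtype, Subtype.range_coe, SetLike.mem_coe, relations, mem_ker,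
          Subtype.ext_iff]
        rfl
  let j := Submodule.inclusion (koszulRelations_le_relations (z := z))
  have hsurj : Surjective (j.lTensor S) := fun t ↦
    (hz.exists_lTensor_inclusion_eq t).imp fun _ hu ↦ hinj hu
  have hzero : ∀ t : S ⊗[R] (relations z ⧸ range j), t = 0 := fun t ↦ by
    obtain ⟨t, rfl⟩ := lTensor_surjective S (range j).mkQ_surjective t
    obtain ⟨u, rfl⟩ := hsurj t
    rw [← LinearMap.comp_apply, ← lTensor_comp, range_mkQ_comp, lTensor_zero, LinearMap.zero_apply]
  have hsub := subsingleton_of_subsingleton_tensor (S := S) (relations z ⧸ range j)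
    ⟨fun a b ↦ by rw [hzero a, hzero b]⟩
  intro a ha
  obtain ⟨b, hb⟩ : (⟨a, ha⟩ : relations z) ∈ range j :=
    (Submodule.Quotient.mk_eq_zero _).1 (Subsingleton.elim _ _)
  have hb' : (b : Fin m → R) = a := congr(($hb : Fin m → R))
  exact hb' ▸ b.2

lemma relations_le_koszulRelations_of_torOneVanishes [Nontrivial (S ⊗[R] ResidueField R)]
    (hz : IsRegularFamily z S) (h : TorOneVanishes R S (ResidueField R)) :
    relations z ≤ koszulRelations z R m := by
  intro a ha
  let B := koszulRelations z R m
  obtain ⟨u, hu⟩ := hz.exists_lTensor_inclusion_eq ((1 : S) ⊗ₜ ⟨a, ha⟩)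
  rw [← LinearMap.comp_apply, ← lTensor_comp, Submodule.subtype_comp_inclusion] at hu
  have h1 : (1 : S) ⊗ₜ[R] B.mkQ a = 0 := by
    have := congr(B.mkQ.lTensor S $hu)
    rw [← LinearMap.comp_apply, ← lTensor_comp, (exact_subtype_mkQ B).linearMap_comp_eq_zero] at this
    simpa using this.symm
  have h2 : B.mkQ a ∈ (⨅ n : ℕ, maximalIdeal R ^ n • ⊤ : Submodule R ((Fin m → R) ⧸ B)) := by
    refine Submodule.mem_iInf _ |>.2 fun n ↦ ?_
    let C := (maximalIdeal R ^ n • ⊤ : Submodule R ((Fin m → R) ⧸ B))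
    refine (Submodule.Quotient.mk_eq_zero C).1
      (eq_zero_of_one_tmul_eq_zero (S := S) h _ n (fun r hr x ↦ ?_) _ ?_)
    · obtain ⟨x, rfl⟩ := C.mkQ_surjective x
      rw [← map_smul, Submodule.mkQ_apply, Submodule.Quotient.mk_eq_zero]
      exact Submodule.smul_mem_smul hr Submodule.mem_top
    · simpa using congr(C.mkQ.lTensor S $h1)
  rw [Ideal.iInf_pow_smul_eq_bot_of_isLocalRing _ (maximalIdeal.isMaximal R).ne_top] at h2
  exact (Submodule.Quotient.mk_eq_zero B).1 h2

lemma nontrivial_tensor_residueField {rs : List R}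
    (hrad : (Ideal.ofList rs).radical = maximalIdeal R)
    (hrs : (⊤ : Submodule R S) ≠ Ideal.ofList rs • ⊤) : Nontrivial (S ⊗[R] ResidueField R) := by
  by_contra hS
  rw [not_nontrivial_iff_subsingleton] at hS
  have hquot : Subsingleton (S ⧸ (maximalIdeal R • ⊤ : Submodule R S)) :=
    (tensorQuotEquivQuotSMul S (maximalIdeal R)).symm.injective.subsingleton
      (β := S ⊗[R] ResidueField R)
  have h1 : (maximalIdeal R • ⊤ : Submodule R S) = ⊤ :=
    top_unique fun x _ ↦ (Submodule.Quotient.mk_eq_zero _).1 (Subsingleton.elim _ _)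
  have h2 (n : ℕ) : (maximalIdeal R ^ n • ⊤ : Submodule R S) = ⊤ := by
    induction n with
    | zero => simp [Ideal.map_top]
    | succ n ih => rw [pow_succ, Submodule.mul_smul, h1, ih]
  obtain ⟨n, hn⟩ := Ideal.exists_radical_pow_le_of_fg _
    (IsNoetherian.noetherian (Ideal.ofList rs).radical)
  rw [hrad] at hn
  exact hrs (top_le_iff.1 ((h2 n).ge.trans (Submodule.smul_mono_left hn))).symm

end Conclusion

end BigCM

/-- If `(R, 𝔪)` is a Noetherian local ring with residue field `k` and `S` is a big
Cohen-Macaulay `R`-algebra such that `Tor_1^R(S, k) = 0` or `Tor_2^R(S, k) = 0`,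
then `R` is Cohen-Macaulay. -/
theorem cohenMacaulay_of_tor_vanishing_bigCM
    (R : Type) [CommRing R] [IsNoetherianRing R] [IsLocalRing R]
    (S : Type) [CommRing S] [Algebra R S]
    (hS : IsBigCohenMacaulayAlgebra R S)
    (htor : Subsingleton (TorGrp R 1 S (IsLocalRing.ResidueField R)) ∨
      Subsingleton (TorGrp R 2 S (IsLocalRing.ResidueField R))) :
    IsCohenMacaulayLocalRing R := by
  obtain ⟨rs, ⟨hmem, hdim, hrad⟩, hreg⟩ := hS
  have := BigCM.nontrivial_tensor_residueField hrad hreg.top_ne_smul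
  have hz := (BigCM.isWeaklyRegular_iff_isRegularFamily rs).1 hreg.toIsWeaklyRegular
  obtain ⟨n, hn⟩ := Ideal.exists_radical_pow_le_of_fg _
    (IsNoetherian.noetherian (Ideal.ofList rs).radical)
  rw [hrad] at hn
  have hrange : Set.range (fun l : Fin rs.length ↦ rs[l]) = {x | x ∈ rs} := Set.range_list_get rs
  have hrel : BigCM.relations (fun l : Fin rs.length ↦ rs[l]) ≤
      BigCM.koszulRelations (fun l : Fin rs.length ↦ rs[l]) R rs.length := by
    rcases htor with h | h
    · exact BigCM.relations_le_koszulRelations_of_torOneVanishes hz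
        (BigCM.torOneVanishes_of_subsingleton_tor h)
    · exact BigCM.relations_le_koszulRelations_of_torTwoVanishes hz n (by rwa [hrange])
        (BigCM.torTwoVanishes_of_subsingleton_tor h)
  have hR : RingTheory.Sequence.IsWeaklyRegular R rs :=
    (BigCM.isWeaklyRegular_iff_isRegularFamily rs).2
      (BigCM.isRegularFamily_of_forall_mem_koszulRelations
        (fun l ↦ hmem _ (List.getElem_mem l.2)) fun v hv ↦ hrel (BigCM.mem_relations_iff.2 hv))
  refine ⟨inferInstance, inferInstance, rs, hmem, ⟨hR, fun htop ↦ ?_⟩, hdim⟩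
  rw [smul_eq_mul, Ideal.mul_top] at htop
  exact (IsLocalRing.maximalIdeal.isMaximal R).ne_top
    (top_le_iff.1 (htop.le.trans (Ideal.span_le.2 hmem)))
end

section
/- Let (R, 𝔪) be an excellent Noetherian local domain of prime characteristic p > 0 with residue field k = R/𝔪, and suppose R has an isolated singularity, i.e. the localization R_𝔭 is a regular local ring for every prime ideal 𝔭 ≠ 𝔪. If Tor_1^R(R^+, k) = 0, then R is a regular local ring. -/
set_option synthInstance.maxHeartbeats 1000000
set_option maxHeartbeats 1000000
set_option linter.unusedVariables false

open CategoryTheory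

section
open Ideal

/-- A family `f` is Lech-independent if the coefficients of every linear relation lie in the
ideal generated by `f`. -/
def LechIndependent {S ι : Type*} [CommRing S] [Fintype ι] (f : ι → S) : Prop :=
  ∀ s : ι → S, ∑ i, s i * f i = 0 → ∀ i, s i ∈ span (Set.range f)

namespace LechIndependent

variable {S ι : Type*} [CommRing S] [DecidableEq ι]

lemma span_le_span_update {f : ι → S} {j : ι} {g h : S} (hf : f j = g * h) :
    span (Set.range f) ≤ span (Set.range (Function.update f j g)) := by
  rw [span_le]
  rintro _ ⟨i, rfl⟩
  by_cases hi : i = j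
  · subst hi
    rw [hf]
    exact mul_mem_right _ _ (subset_span ⟨i, by simp⟩)
  · exact subset_span ⟨i, by simp [hi]⟩

variable [Fintype ι]

lemma update_of_eq_mul {f : ι → S} (hf : LechIndependent f) {j : ι} {g h : S}
    (hj : f j = g * h) : LechIndependent (Function.update f j g) := by
  intro s hs
  have hsum (a : ι → S) (b c : S) :
      ∑ i, Function.update a j b i * Function.update f j c i
        = b * c + ∑ i ∈ Finset.univ.erase j, a i * f i := by
    rw [← Finset.add_sum_erase _ _ (Finset.mem_univ j)]
    congr 1
    · simp
    · refine Finset.sum_congr rfl fun i hi ↦ ?_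
      simp [Finset.ne_of_mem_erase hi]
  have hs' : s j * g + ∑ i ∈ Finset.univ.erase j, s i * f i = 0 := by
    rw [← hsum, Function.update_eq_self, hs]
  have hsj : s j ∈ span (Set.range f) := by
    have := hf (Function.update (fun i ↦ h * s i) j (s j)) (by
      have := hsum (fun i ↦ h * s i) (s j) (f j)
      rw [Function.update_eq_self] at this
      rw [this, hj]
      simp only [mul_assoc, ← Finset.mul_sum]
      linear_combination h * hs') j
    simpa using this
  obtain ⟨c, hc⟩ := (mem_span_range_iff_exists_fun).1 hsj
  have ht := hf (fun i ↦ if i = j then g * c j else s i + g * c i) (by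
    rw [← Finset.add_sum_erase _ _ (Finset.mem_univ j)] at hc ⊢
    rw [if_pos rfl, Finset.sum_congr rfl (g := fun i ↦ s i * f i + g * (c i * f i))]
    · rw [Finset.sum_add_distrib, ← Finset.mul_sum]
      linear_combination g * hc + hs'
    · intro i hi
      rw [if_neg (Finset.ne_of_mem_erase hi)]
      ring)
  intro i
  by_cases hi : i = j
  · exact hi ▸ span_le_span_update hj hsj
  · have h1 := span_le_span_update hj (ht i)
    rw [if_neg hi] at h1
    refine ((Submodule.add_mem_iff_left _ (mul_mem_right _ _ ?_)).1 h1)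
    exact subset_span ⟨j, by simp⟩

lemma mem_of_mul_mem {f : ι → S} (hf : LechIndependent f) {j : ι} {g h u : S}
    (hj : f j = g * h) (hg : h ∈ span {g}) (hu : h * u ∈ span (Set.range f)) :
    u ∈ span (Set.range (Function.update f j g)) := by
  obtain ⟨c, hc⟩ := (mem_span_range_iff_exists_fun).1 hu
  have hgm : g ∈ span (Set.range (Function.update f j g)) := subset_span ⟨j, by simp⟩
  have h1 := hf.update_of_eq_mul (hj.trans (mul_comm g h))
    (Function.update (fun i ↦ - c i) j (u - c j * g)) (by
    rw [← Finset.add_sum_erase _ _ (Finset.mem_univ j)] at hc ⊢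
    rw [Finset.sum_congr rfl (g := fun i ↦ - (c i * f i))]
    · rw [Finset.sum_neg_distrib]
      simp only [Function.update_self]
      linear_combination c j * hj - hc
    · intro i hi
      simp [Finset.ne_of_mem_erase hi]) j
  rw [Function.update_self] at h1
  have hle : span (Set.range (Function.update f j h)) ≤
      span (Set.range (Function.update f j g)) := by
    rw [span_le]
    rintro _ ⟨i, rfl⟩
    by_cases hi : i = j
    · subst hi
      rw [Function.update_self]
      exact (span_singleton_le_iff_mem _).2 hgm hg
    · exact subset_span ⟨i, by simp [hi]⟩
  exact (Submodule.sub_mem_iff_left _ (mul_mem_left _ _ hgm)).1 (hle h1)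

/-- If the `q`-th powers of a family generating a proper ideal are Lech-independent, then the
`q - 1`-st power of its product does not lie in the ideal generated by these `q`-th powers. -/
theorem prod_pow_notMem {z : ι → S} {q : ℕ} (hq : 2 ≤ q) (hz : LechIndependent fun i ↦ z i ^ q)
    (hne : span (Set.range z) ≠ ⊤) :
    ∏ i, z i ^ (q - 1) ∉ span (Set.range fun i ↦ z i ^ q) := by
  intro hmem
  have key (A : Finset ι) : LechIndependent (A.piecewise z fun i ↦ z i ^ q) ∧
      ∏ i ∈ Aᶜ, z i ^ (q - 1) ∈ span (Set.range (A.piecewise z fun i ↦ z i ^ q)) := by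
    induction A using Finset.induction_on with
    | empty => simpa using ⟨hz, hmem⟩
    | insert j A hj ih =>
      obtain ⟨h1, h2⟩ := ih
      have hfj : A.piecewise z (fun i ↦ z i ^ q) j = z j * z j ^ (q - 1) := by
        rw [Finset.piecewise_eq_of_notMem _ _ _ hj, ← pow_succ']
        congr 1; omega
      rw [Finset.piecewise_insert]
      refine ⟨h1.update_of_eq_mul hfj, h1.mem_of_mul_mem hfj ?_ ?_⟩
      · exact mem_span_singleton.2 (dvd_pow_self _ (by omega))
      · rwa [Finset.compl_insert, Finset.mul_prod_erase _ (fun i ↦ z i ^ (q - 1))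
        (Finset.mem_compl.2 hj)]
  apply hne
  simpa [eq_top_iff_one] using (key Finset.univ).2

end LechIndependent

lemma prod_pow_notMem_of_lechIndependent {R S ι : Type*} [CommRing R] [CommRing S] [IsReduced S]
    [Algebra R S] [Fintype ι] (p : ℕ) [Fact p.Prime] [CharP S p]
    (hroot : ∀ a : S, ∃ b, b ^ p = a) {x : ι → R}
    (hx : LechIndependent fun i ↦ algebraMap R S (x i))
    (hne : span (Set.range fun i ↦ algebraMap R S (x i)) ≠ ⊤) {e : ℕ} (he : e ≠ 0) :
    ∏ i, x i ^ (p ^ e - 1) ∉ span (Set.range fun i ↦ x i ^ p ^ e) := by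
  classical
  have hp : p.Prime := Fact.out
  have hroot' (a : S) : ∃ b, b ^ p ^ e = a := by
    clear he
    induction e with
    | zero => exact ⟨a, by simp⟩
    | succ e ih =>
      obtain ⟨b, rfl⟩ := ih
      obtain ⟨c, rfl⟩ := hroot b
      exact ⟨c, by rw [← pow_mul, pow_succ']⟩
  choose ρ hρ using hroot'
  have hq : 2 ≤ p ^ e := hp.two_le.trans (Nat.le_self_pow he p)
  set z : ι → S := fun i ↦ ρ (algebraMap R S (x i)) with hzdef
  have hz (i) : z i ^ p ^ e = algebraMap R S (x i) := hρ _
  simp only [← hz] at hx hne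
  intro hmem
  refine hx.prod_pow_notMem hq ?_ ?_
  · intro htop
    obtain ⟨Q, hQ, hle⟩ := exists_le_maximal _ hne
    refine hQ.ne_top (top_le_iff.1 (htop.ge.trans (span_le.2 ?_)))
    rintro _ ⟨i, rfl⟩
    exact hQ.isPrime.mem_of_pow_mem _ (hle (subset_span ⟨i, rfl⟩))
  · obtain ⟨c, hc⟩ := (mem_span_range_iff_exists_fun).1 hmem
    refine (mem_span_range_iff_exists_fun).2 ⟨fun i ↦ ρ (algebraMap R S (c i)), ?_⟩
    rw [← sub_eq_zero]
    refine (pow_eq_zero_iff (n := p ^ e) (by positivity)).1 ?_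
    rw [sub_pow_char_pow, sum_pow_char_pow, sub_eq_zero]
    have := congrArg (algebraMap R S) hc
    simp only [map_sum, map_mul, map_prod, map_pow, ← hz] at this
    simp only [mul_pow, hρ, ← Finset.prod_pow, ← pow_mul] at this ⊢
    rw [this]
    exact Finset.prod_congr rfl fun i _ ↦ by rw [mul_comm]

end

section
open Ideal

universe u

lemma Module.le_length_of_prod_pow_smul_ne_zero {R ι : Type*} [CommRing R] (x : ι → R) {q : ℕ}
    (s : Finset ι) {M : Type u} [AddCommGroup M] [Module R M] (v : M)
    (hv : ∀ i ∈ s, x i ^ q • v = 0) (hne : (∏ i ∈ s, x i ^ (q - 1)) • v ≠ 0) :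
    ((q ^ s.card : ℕ) : ℕ∞) ≤ Module.length R M := by
  classical
  induction s using Finset.induction_on generalizing M with
  | empty =>
    have : Nontrivial M := ⟨v, 0, by simpa using hne⟩
    simpa [Order.one_le_iff_ne_zero, Module.length_eq_zero_iff, not_subsingleton_iff_nontrivial]
  | insert j s hj ih =>
    set a := ∏ i ∈ s, x i ^ (q - 1)
    have key (k : ℕ) : ∀ (N : Type u) [AddCommGroup N] [Module R N] (w : N),
        x j ^ (k + 1) • w = 0 → (∀ i ∈ s, x i ^ q • w = 0) → a • x j ^ k • w ≠ 0 →
        (((k + 1) * q ^ s.card : ℕ) : ℕ∞) ≤ Module.length R N := by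
      induction k with
      | zero =>
        intro N _ _ w _ h2 h3
        simpa using ih w h2 (by simpa using h3)
      | succ k ihk =>
        intro N _ _ w h1 h2 h3
        let N' : Submodule R N := Submodule.span R {x j • w}
        rw [Module.length_eq_add_of_exact N'.subtype N'.mkQ N'.injective_subtype
          N'.mkQ_surjective (LinearMap.exact_subtype_mkQ N')]
        rw [add_mul, one_mul, Nat.cast_add]
        refine add_le_add (ihk N' ⟨x j • w, Submodule.mem_span_singleton_self _⟩ ?_
          (fun i hi ↦ ?_) ?_) (ih (N'.mkQ w) (fun i hi ↦ ?_) ?_)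
        · ext1
          simpa [smul_smul, ← pow_succ] using h1
        · ext1
          simp [smul_comm _ (x j), h2 i hi]
        · intro h
          apply h3
          simpa [smul_smul, ← pow_succ, mul_assoc] using congrArg Subtype.val h
        · rw [← map_smul, h2 i hi, map_zero]
        · rw [← map_smul, Ne, Submodule.mkQ_apply, Submodule.Quotient.mk_eq_zero,
            Submodule.mem_span_singleton]
          rintro ⟨r, hr⟩
          apply h3
          rw [smul_comm, ← hr, smul_comm _ r, smul_smul (x j ^ _), ← pow_succ, h1, smul_zero]
    rcases q with _ | q
    · simp [Finset.card_insert_of_notMem hj]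
    · rw [Finset.card_insert_of_notMem hj, pow_succ']
      refine key q M v (hv j (Finset.mem_insert_self _ _))
        (fun i hi ↦ hv i (Finset.mem_insert_of_mem hi)) fun h ↦ hne ?_
      rw [Finset.prod_insert hj, mul_comm, mul_smul]
      simpa [a] using h

lemma Module.length_quotient_le_add {R : Type*} [CommRing R] {I J K : Ideal R} {a : R}
    (hK : K ≤ I ⊔ span {a}) (hJ : ∀ b ∈ J, a * b ∈ I) :
    Module.length R (R ⧸ I) ≤ Module.length R (R ⧸ J) + Module.length R (R ⧸ K) := by
  let N : Submodule R (R ⧸ I) := Submodule.span R {Submodule.Quotient.mk a}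
  rw [Module.length_eq_add_of_exact N.subtype N.mkQ N.injective_subtype
    N.mkQ_surjective (LinearMap.exact_subtype_mkQ N)]
  refine add_le_add ?_ ?_
  · refine Module.length_le_of_surjective (Submodule.liftQ J (LinearMap.toSpanSingleton R N
      ⟨Submodule.Quotient.mk a, Submodule.mem_span_singleton_self _⟩) ?_) ?_
    · intro b hb
      ext1
      simp only [LinearMap.toSpanSingleton_apply, Submodule.coe_smul, ZeroMemClass.coe_zero]
      rw [← Submodule.Quotient.mk_smul, Submodule.Quotient.mk_eq_zero, smul_eq_mul, mul_comm]
      exact hJ b hb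
    · rintro ⟨y, hy⟩
      obtain ⟨r, rfl⟩ := Submodule.mem_span_singleton.1 hy
      exact ⟨Submodule.Quotient.mk r, rfl⟩
  · refine Module.length_le_of_surjective (Submodule.liftQ K (N.mkQ ∘ₗ I.mkQ) ?_) ?_
    · intro b hb
      obtain ⟨c, hc, d, hd, rfl⟩ := Submodule.mem_sup.1 (hK hb)
      obtain ⟨r, rfl⟩ := Submodule.mem_span_singleton.1 hd
      rw [LinearMap.mem_ker, LinearMap.comp_apply, map_add, (Submodule.mkQ_apply I c).trans
        ((Submodule.Quotient.mk_eq_zero I).2 hc), zero_add]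
      exact (Submodule.Quotient.mk_eq_zero N).2 (Submodule.mem_span_singleton.2 ⟨r, rfl⟩)
    · intro y
      obtain ⟨y, rfl⟩ := N.mkQ_surjective y
      obtain ⟨y, rfl⟩ := I.mkQ_surjective y
      exact ⟨Submodule.Quotient.mk y, rfl⟩

lemma Module.length_quotient_sup_span_pow_le {R : Type*} [CommRing R] (I : Ideal R) (y : R)
    (q : ℕ) : Module.length R (R ⧸ (I ⊔ span {y ^ q})) ≤
      q * Module.length R (R ⧸ (I ⊔ span {y})) := by
  induction q with
  | zero =>
    have : Subsingleton (R ⧸ (I ⊔ span {y ^ 0})) := by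
      rw [Ideal.Quotient.subsingleton_iff]
      simp
    simp [Module.length_eq_zero]
  | succ q ih =>
    rw [Nat.cast_succ, add_mul, one_mul, add_comm (_ * _)]
    refine (length_quotient_le_add (a := y ^ q) (J := I ⊔ span {y}) (K := I ⊔ span {y ^ q})
      ?_ ?_).trans (add_le_add_right ih _)
    · exact sup_le (le_sup_left.trans le_sup_left) le_sup_right
    · intro b hb
      obtain ⟨c, hc, d, hd, rfl⟩ := Submodule.mem_sup.1 hb
      obtain ⟨r, rfl⟩ := Ideal.mem_span_singleton.1 hd
      rw [mul_add, ← mul_assoc, ← pow_succ]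
      exact add_mem (mem_sup_left (mul_mem_left _ _ hc))
        (mem_sup_right (mul_mem_right _ _ (mem_span_singleton_self _)))

lemma Module.length_quotient_sup_span_image_pow_le {R : Type*} [CommRing R] (s : Finset R) (q : ℕ)
    (I : Ideal R) : Module.length R (R ⧸ (I ⊔ span ((· ^ q) '' (s : Set R)))) ≤
      (q ^ s.card : ℕ) * Module.length R (R ⧸ (I ⊔ span (s : Set R))) := by
  classical
  induction s using Finset.induction_on generalizing I with
  | empty =>
    have h : ((· ^ q) '' ((∅ : Finset R) : Set R)) = ((∅ : Finset R) : Set R) := by simp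
    rw [h, Finset.card_empty, pow_zero, Nat.cast_one, one_mul]
  | insert y s hy ih =>
    have h1 : I ⊔ span ((· ^ q) '' (insert y s : Finset R)) =
        I ⊔ span {y ^ q} ⊔ span ((· ^ q) '' (s : Set R)) := by
      rw [Finset.coe_insert, Set.image_insert_eq, span_insert, sup_assoc]
    have h2 : I ⊔ span (insert y s : Finset R) = I ⊔ span (s : Set R) ⊔ span {y} := by
      rw [Finset.coe_insert, span_insert, sup_right_comm, sup_assoc]
    have h3 := length_quotient_sup_span_pow_le (I ⊔ span (s : Set R)) y q
    rw [sup_right_comm] at h3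
    rw [h1, h2, Finset.card_insert_of_notMem hy, pow_succ, Nat.cast_mul, mul_assoc]
    exact (ih _).trans (by gcongr)

end

section
open TensorProduct

lemma mem_map_of_tmul_residue_eq_zero {R S : Type*} [CommRing R] [CommRing S] [Algebra R S]
    [IsLocalRing R] {s : S}
    (h : s ⊗ₜ[R] (1 : IsLocalRing.ResidueField R) = 0) :
    s ∈ (IsLocalRing.maximalIdeal R).map (algebraMap R S) := by
  rw [← Ideal.Quotient.eq_zero_iff_mem,
    ← (Algebra.TensorProduct.quotIdealMapEquivTensorQuot S
      (IsLocalRing.maximalIdeal R)).map_eq_zero_iff]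
  exact h

/-- If `Tor₁(S, k) = 0`, tensoring a projective resolution of `k` with `S` gives a complex that is
exact in degree one. -/
lemma exists_lTensor_resolution_eq_of_tor_one {R : Type} [CommRing R] (S N : Type)
    [AddCommGroup S] [Module R S] [AddCommGroup N] [Module R N]
    (h : Subsingleton (((Tor (ModuleCat R) 1).obj (ModuleCat.of R S)).obj (ModuleCat.of R N)))
    (P : ProjectiveResolution (ModuleCat.of R N)) (ω : S ⊗[R] P.complex.X 1)
    (hω : (P.complex.d 1 0).hom.lTensor S ω = 0) :
    ∃ η, (P.complex.d 2 1).hom.lTensor S η = ω := by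
  let F := (MonoidalCategory.tensoringLeft (ModuleCat R)).obj (ModuleCat.of R S)
  have h1 : Limits.IsZero (((F.mapHomologicalComplex _).obj P.complex).homology 1) :=
    (@ModuleCat.isZero_of_subsingleton R _ _ h).of_iso (P.isoLeftDerivedObj F 1).symm
  rw [← HomologicalComplex.exactAt_iff_isZero_homology,
    HomologicalComplex.exactAt_iff' _ 2 1 0 (by simp) (by simp),
    ShortComplex.moduleCat_exact_iff] at h1
  exact h1 ω hω

theorem mem_map_of_sum_smul_eq_zero_of_tor_one {R S : Type} [CommRing R] [IsLocalRing R]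
    [CommRing S] [Algebra R S]
    (h : Subsingleton (((Tor (ModuleCat R) 1).obj (ModuleCat.of R S)).obj
      (ModuleCat.of R (IsLocalRing.ResidueField R))))
    {ι : Type*} [Fintype ι]
    (b : Module.Basis ι (IsLocalRing.ResidueField R) (IsLocalRing.CotangentSpace R))
    {x : ι → IsLocalRing.maximalIdeal R}
    (hx : ∀ i, (IsLocalRing.maximalIdeal R).toCotangent (x i) = b i)
    {s : ι → S} (hs : ∑ i, s i * algebraMap R S (x i) = 0) (i : ι) :
    s i ∈ (IsLocalRing.maximalIdeal R).map (algebraMap R S) := by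
  classical
  let k := IsLocalRing.ResidueField R
  let m := IsLocalRing.maximalIdeal R
  obtain ⟨P⟩ := HasProjectiveResolution.out (Z := ModuleCat.of R k)
  let π : P.complex.X 0 →ₗ[R] k := (P.π.f 0).hom
  have hπ : Function.Surjective π := (ModuleCat.epi_iff_surjective (P.π.f 0)).1 inferInstance
  have : Module.Projective R (P.complex.X 0) :=
    (IsProjective.iff_projective (R := R) (P.complex.X 0)).2 (P.projective 0)
  obtain ⟨c, hc⟩ := Module.projective_lifting_property
    (Algebra.linearMap R k) π IsLocalRing.residue_surjective
  have hcπ (y) : IsLocalRing.residue R (c y) = π y := LinearMap.congr_fun hc y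
  have hπd (y) : π ((P.complex.d 1 0).hom y) = 0 :=
    LinearMap.congr_fun (congrArg ModuleCat.Hom.hom P.complex_d_comp_π_f_zero) y
  have hdd (y) : (P.complex.d 1 0).hom ((P.complex.d 2 1).hom y) = 0 :=
    LinearMap.congr_fun (congrArg ModuleCat.Hom.hom (P.complex.d_comp_d 2 1 0)) y
  obtain ⟨a, ha⟩ := hπ 1
  have hβ (j : ι) : ∃ β, (P.complex.d 1 0).hom β = (x j : R) • a := by
    refine (ShortComplex.moduleCat_exact_iff _).1 P.exact₀ ((x j : R) • a) ?_
    change π ((x j : R) • a) = 0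
    rw [map_smul, ha, Algebra.smul_def, mul_one]
    exact (IsLocalRing.residue_eq_zero_iff _).2 (x j).2
  choose β hβ using hβ
  let φ : P.complex.X 1 →ₗ[R] k := (b.coord i).restrictScalars R ∘ₗ m.toCotangent ∘ₗ
    (c ∘ₗ (P.complex.d 1 0).hom).codRestrict m fun y ↦
      (IsLocalRing.residue_eq_zero_iff _).1 ((hcπ _).trans (hπd y))
  have hφd : φ ∘ₗ (P.complex.d 2 1).hom = 0 := by
    ext y
    have : (c ∘ₗ (P.complex.d 1 0).hom).codRestrict m (fun y ↦
        (IsLocalRing.residue_eq_zero_iff _).1 ((hcπ _).trans (hπd y)))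
        ((P.complex.d 2 1).hom y) = 0 := by
      ext1
      simp [hdd]
    simp only [φ, LinearMap.comp_apply, this, map_zero, LinearMap.zero_apply]
  have hφβ (j : ι) : φ (β j) = if j = i then 1 else 0 := by
    have : (c ∘ₗ (P.complex.d 1 0).hom).codRestrict m (fun y ↦
        (IsLocalRing.residue_eq_zero_iff _).1 ((hcπ _).trans (hπd y))) (β j) = c a • x j := by
      ext1
      simp [hβ, mul_comm]
    simp only [φ, LinearMap.comp_apply, this, map_smul]
    rw [show m.toCotangent (x j) = b j from hx j]
    simp only [LinearMap.coe_restrictScalars, Module.Basis.coord_apply, Module.Basis.repr_self,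
      Finsupp.single_apply]
    rw [Algebra.smul_def]
    exact (congrArg (· * _) ((hcπ a).trans ha)).trans (one_mul _)
  obtain ⟨η, hη⟩ := exists_lTensor_resolution_eq_of_tor_one S k h P (∑ j, s j ⊗ₜ β j) (by
    simp only [map_sum, LinearMap.lTensor_tmul, hβ, ← TensorProduct.smul_tmul]
    rw [← TensorProduct.sum_tmul]
    simp only [Algebra.smul_def, mul_comm (algebraMap R S _), hs, TensorProduct.zero_tmul])
  apply mem_map_of_tmul_residue_eq_zero
  have := congrArg (φ.lTensor S) hη
  rw [← LinearMap.comp_apply, ← LinearMap.lTensor_comp, hφd] at this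
  simpa [hφβ, TensorProduct.tmul_ite] using this.symm

end

section
open IsLocalRing

lemma Module.length_quotient_ne_top_of_mem_minimalPrimes {R : Type*} [CommRing R]
    [IsNoetherianRing R] [IsLocalRing R] {I : Ideal R} (hI : maximalIdeal R ∈ I.minimalPrimes) :
    Module.length R (R ⧸ I) ≠ ⊤ := by
  have := quotient_artinian_of_mem_minimalPrimes_of_isLocalRing I hI
  rw [Module.length_eq_of_surjective (S := R) (R := R ⧸ I) Ideal.Quotient.mk_surjective]
  exact Module.length_ne_top

/-- A bound on the number of elements of a family in the maximal ideal from the nonvanishing of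
its monomials modulo Frobenius powers. -/
theorem card_le_ringKrullDim_of_prod_pow_notMem {R ι : Type*} [CommRing R] [IsNoetherianRing R]
    [IsLocalRing R] [Fintype ι] {p : ℕ} (hp : p.Prime) [CharP R p] {x : ι → R}
    (hspan : Ideal.span (Set.range x) = maximalIdeal R)
    (hx : ∀ e ≠ 0, ∏ i, x i ^ (p ^ e - 1) ∉ Ideal.span (Set.range fun i ↦ x i ^ p ^ e)) :
    (Fintype.card ι : WithBot ℕ∞) ≤ ringKrullDim R := by
  have : Fact p.Prime := ⟨hp⟩
  obtain ⟨y, hy, hcard⟩ := (maximalIdeal R).exists_finset_card_eq_height_of_isNoetherianRing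
  rw [← maximalIdeal_height_eq_ringKrullDim, ← hcard]
  obtain ⟨C, hC⟩ := ENat.ne_top_iff_exists.1 (Module.length_quotient_ne_top_of_mem_minimalPrimes hy)
  have hbound (e : ℕ) (he : e ≠ 0) :
      (p ^ e) ^ Fintype.card ι ≤ (p ^ e) ^ y.card * C := by
    let I := Ideal.span (Set.range fun i ↦ x i ^ p ^ e)
    have hlow := Module.le_length_of_prod_pow_smul_ne_zero x (q := p ^ e) Finset.univ
      (Submodule.Quotient.mk 1 : R ⧸ I) (fun i _ ↦ by
        rw [← Submodule.Quotient.mk_smul, Submodule.Quotient.mk_eq_zero, smul_eq_mul, mul_one]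
        exact Ideal.subset_span ⟨i, rfl⟩) (by
        rw [← Submodule.Quotient.mk_smul, Ne, Submodule.Quotient.mk_eq_zero, smul_eq_mul, mul_one]
        exact hx e he)
    have hup := Module.length_quotient_sup_span_image_pow_le y (p ^ e) (⊥ : Ideal R)
    rw [bot_sup_eq, bot_sup_eq, ← hC] at hup
    have hle : Ideal.span ((· ^ p ^ e) '' (y : Set R)) ≤ I := by
      rw [Ideal.span_le]
      rintro _ ⟨a, ha, rfl⟩
      have ham : a ∈ Ideal.span (Set.range x) := hspan ▸ hy.1.2 (Ideal.subset_span ha)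
      obtain ⟨c, rfl⟩ := (Ideal.mem_span_range_iff_exists_fun).1 ham
      simp only [SetLike.mem_coe, sum_pow_char_pow, mul_pow]
      exact sum_mem fun i _ ↦ Ideal.mul_mem_left _ _ (Ideal.subset_span ⟨i, rfl⟩)
    have hmid : Module.length R (R ⧸ I) ≤
        Module.length R (R ⧸ Ideal.span ((· ^ p ^ e) '' (y : Set R))) :=
      Module.length_le_of_surjective (Submodule.factor hle) (Submodule.factor_surjective hle)
    have := hlow.trans (hmid.trans hup)
    rw [Finset.card_univ] at this
    exact_mod_cast this
  suffices Fintype.card ι ≤ y.card by exact_mod_cast this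
  by_contra! hlt
  have h1 := hbound (C + 1) (by omega)
  have h2 : C + 1 < p ^ (C + 1) := Nat.lt_pow_self hp.one_lt
  have h3 : 0 < p ^ (C + 1) := by omega
  have h4 := (Nat.pow_le_pow_right h3 hlt).trans h1
  rw [pow_succ] at h4
  have := Nat.le_of_mul_le_mul_left h4 (by positivity)
  omega

end

lemma AbsIntClo.algebraMap_injective (R : Type) [CommRing R] [IsDomain R] :
    Function.Injective (algebraMap R (AbsIntClo R)) := fun a b h ↦ by
  have : algebraMap R (AlgebraicClosure (FractionRing R)) a =
      algebraMap R (AlgebraicClosure (FractionRing R)) b := congrArg Subtype.val h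
  rw [IsScalarTower.algebraMap_apply R (FractionRing R),
    IsScalarTower.algebraMap_apply R (FractionRing R) _ b] at this
  exact IsFractionRing.injective R _ ((algebraMap (FractionRing R) _).injective this)

lemma AbsIntClo.exists_pow_eq {R : Type} [CommRing R] [IsDomain R] {n : ℕ} (hn : n ≠ 0)
    (a : AbsIntClo R) : ∃ b, b ^ n = a := by
  obtain ⟨b, hb⟩ := IsAlgClosed.exists_pow_nat_eq (a : AlgebraicClosure (FractionRing R))
    (Nat.pos_of_ne_zero hn)
  exact ⟨⟨b, IsIntegral.of_pow (Nat.pos_of_ne_zero hn) (hb ▸ a.2)⟩, Subtype.ext hb⟩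

/-- If `(R, 𝔪)` is an excellent local domain of prime characteristic `p` with an isolated
singularity and `Tor_1^R(R⁺, k) = 0`, then `R` is regular. -/
theorem regular_of_tor_one_vanishing_isolated_singularity
    (R : Type) [CommRing R] [IsDomain R] [IsNoetherianRing R] [IsLocalRing R]
    (hExc : IsExcellentRing R)
    (p : ℕ) (hp : p.Prime) [CharP R p]
    (hiso : ∀ (q : Ideal R) (hq : q.IsPrime), q ≠ IsLocalRing.maximalIdeal R →
      haveI := hq
      IsRegularLocalRingP (Localization.AtPrime q))
    (htor : Subsingleton (TorGrp R 1 (AbsIntClo R) (IsLocalRing.ResidueField R))) :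
    IsRegularLocalRingP R := by
  classical
  have : Fact p.Prime := ⟨hp⟩
  let b := Module.finBasis (IsLocalRing.ResidueField R) (IsLocalRing.CotangentSpace R)
  choose x hx using fun i ↦ (IsLocalRing.maximalIdeal R).toCotangent_surjective (b i)
  have hspan' : Submodule.span R (Set.range x) = ⊤ := by
    rw [← IsLocalRing.CotangentSpace.span_image_eq_top_iff, ← Set.range_comp]
    exact (congrArg (fun f ↦ Submodule.span _ (Set.range f)) (funext hx)).trans b.span_eq
  have hspan : Ideal.span (Set.range fun i ↦ (x i : R)) = IsLocalRing.maximalIdeal R := by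
    have := congrArg (Submodule.map (IsLocalRing.maximalIdeal R).subtype) hspan'
    rwa [Submodule.map_span, Submodule.map_top, Submodule.range_subtype, ← Set.range_comp] at this
  have hspanS : Ideal.span (Set.range fun i ↦ algebraMap R (AbsIntClo R) (x i)) =
      (IsLocalRing.maximalIdeal R).map (algebraMap R (AbsIntClo R)) := by
    refine Eq.trans ?_ (congrArg (Ideal.map _) hspan)
    rw [Ideal.map_span, ← Set.range_comp]
    rfl
  have hinj : Function.Injective (algebraMap R (AbsIntClo R)) :=
    AbsIntClo.algebraMap_injective R
  have : CharP (AbsIntClo R) p := charP_of_injective_algebraMap hinj p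
  have hne : (IsLocalRing.maximalIdeal R).map (algebraMap R (AbsIntClo R)) ≠ ⊤ := by
    obtain ⟨Q, hQ, hQm⟩ := Ideal.exists_ideal_over_maximal_of_isIntegral (S := AbsIntClo R)
      (IsLocalRing.maximalIdeal R) (by simp [(RingHom.injective_iff_ker_eq_bot _).1 hinj])
    exact fun h ↦ hQ.ne_top (top_le_iff.1 (h.ge.trans (Ideal.map_le_iff_le_comap.2 hQm.ge)))
  have hlech : LechIndependent fun i ↦ algebraMap R (AbsIntClo R) (x i) := fun s hs i ↦
    hspanS ▸ mem_map_of_sum_smul_eq_zero_of_tor_one htor b hx hs i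
  have hle := card_le_ringKrullDim_of_prod_pow_notMem hp hspan fun e he ↦
    prod_pow_notMem_of_lechIndependent p (AbsIntClo.exists_pow_eq hp.ne_zero) hlech
      (hspanS ▸ hne) he
  refine ⟨inferInstance, inferInstance, Finset.univ.image fun i ↦ (x i : R), by simpa using hspan,
    le_antisymm (le_trans ?_ hle) ?_⟩
  · exact_mod_cast Finset.card_image_le
  · rw [← IsLocalRing.maximalIdeal_height_eq_ringKrullDim]
    refine WithBot.coe_le_coe.2 (Ideal.height_le_card_of_mem_minimalPrimes_span_finset ?_)
    have : Ideal.span ((Finset.univ.image fun i ↦ (x i : R) : Finset R) : Set R) =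
        IsLocalRing.maximalIdeal R := by simpa using hspan
    rw [this, Ideal.minimalPrimes_eq_subsingleton_self]
    rfl
end
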